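/- Let U ⊆ ℝⁿ be an open connected neighbourhood of 0 and let f : U → ℝ be a real-analytic function, not identically zero, with f(0) = 0. Let P ∈ ℝ[x₁,…,xₙ,y] be an irreducible polynomial such that P(x, f(x)) = 0 for all x ∈ U, let d = deg P, let Z = {x ∈ U : f(x) = 0}, and set k = 2(2d−1)^(3n+1). Then for any two C^k functions f₁ : U₁ → ℝ and f₂ : U₂ → ℝ on open neighbourhoods U₁, U₂ of 0 that are both C^k-Z-realizations of the k-Z-jet of f, there exist open neighbourhoods Ω₁ ⊆ U₁ and Ω₂ ⊆ U₂ of 0 and a homeomorphism φ : (f₁⁻¹(0) ∪ Z) ∩ Ω₁ → (f₂⁻¹(0) ∪ Z) ∩ Ω₂ such that φ(0) = 0 and φ(Z ∩ Ω₁) = Z ∩ Ω₂. -/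

import Mathlib

open ArchimedeanClass in
/-- A finite sum of terms whose archimedean classes are pairwise distinct has the class of one of
its terms. -/
lemma exists_mk_sum_eq {K ι : Type*} [AddCommGroup K] [LinearOrder K] [IsOrderedAddMonoid K]
    (a : ι → K) (t : Finset ι) (ht : t.Nonempty)
    (hinj : Set.InjOn (fun i => mk (a i)) t) :
    ∃ i ∈ t, mk (∑ j ∈ t, a j) = mk (a i) := by
  classical
  induction ht using Finset.Nonempty.cons_induction with
  | singleton i => exact ⟨i, by simp⟩
  | cons i t hi ht ih =>
    obtain ⟨j, hj, hjs⟩ := ih (hinj.mono (by simp))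
    rw [Finset.sum_cons]
    have hne : mk (a i) ≠ mk (a j) := by
      intro h
      have := hinj (by simp) (by simp [hj]) h
      exact hi (this ▸ hj)
    rcases lt_or_gt_of_ne hne with h | h
    · exact ⟨i, by simp, mk_add_eq_mk_left (by rwa [hjs])⟩
    · exact ⟨j, by simp [hj], by rw [← hjs]; exact mk_add_eq_mk_right (by rwa [hjs])⟩

/-- The structure map of an ordered real algebra, as an ordered ring homomorphism. -/
noncomputable def realOrderHom (K : Type*) [Field K] [LinearOrder K] [IsStrictOrderedRing K]
    [Algebra ℝ K] : ℝ →+*o K :=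
  { algebraMap ℝ K with
    monotone' := by
      intro a b hab
      have h : algebraMap ℝ K b = algebraMap ℝ K a + algebraMap ℝ K (√(b - a)) ^ 2 := by
        rw [← map_pow, Real.sq_sqrt (sub_nonneg.2 hab), ← map_add]; congr 1; ring
      change algebraMap ℝ K a ≤ algebraMap ℝ K b
      rw [h]
      linarith [sq_nonneg (algebraMap ℝ K (√(b - a)))] }

section core
open ArchimedeanClass Polynomial

lemma mk_add_nonneg {K : Type*} [Field K] [LinearOrder K] [IsStrictOrderedRing K] {a b : K} (ha : 0 ≤ mk a) (hb : 0 ≤ mk b) : 0 ≤ mk (a + b) :=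
  (le_min ha hb).trans (min_le_mk_add _ _)

lemma mk_mul_nonneg {K : Type*} [Field K] [LinearOrder K] [IsStrictOrderedRing K] {a b : K} (ha : 0 ≤ mk a) (hb : 0 ≤ mk b) : 0 ≤ mk (a * b) := by
  rw [mk_mul]; exact add_nonneg ha hb

lemma mk_pow_nonneg {K : Type*} [Field K] [LinearOrder K] [IsStrictOrderedRing K] {a : K} (ha : 0 ≤ mk a) (n : ℕ) : 0 ≤ mk (a ^ n) := by
  rw [mk_pow]; exact nsmul_nonneg ha n

lemma mk_nonneg_of_pow {K : Type*} [Field K] [LinearOrder K] [IsStrictOrderedRing K] {a : K} {n : ℕ} (hn : 0 < n) (h : 0 ≤ mk (a ^ n)) : 0 ≤ mk a := by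
  rw [mk_pow] at h
  by_contra! h2
  refine absurd h (not_le.2 ?_)
  obtain ⟨m, rfl⟩ : ∃ m, n = m + 1 := ⟨n - 1, by omega⟩
  rw [succ_nsmul]
  exact lt_of_le_of_lt (add_le_of_nonpos_left (nsmul_nonpos h2.le m)) h2

variable {K : Type*} [Field K] [LinearOrder K] [IsStrictOrderedRing K] [Algebra ℝ K]

lemma mk_algebraMap_real_nonneg (r : ℝ) : 0 ≤ mk (algebraMap ℝ K r) :=
  mk_map_nonneg_of_archimedean (realOrderHom K) r

lemma mk_algebraMap_real {r : ℝ} (hr : r ≠ 0) : mk (algebraMap ℝ K r) = 0 :=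
  mk_map_of_archimedean' (realOrderHom K) hr

lemma mk_aeval_nonneg {s : K} (hs : 0 ≤ mk s) (a : ℝ[X]) : 0 ≤ mk (aeval s a) := by
  induction a using Polynomial.induction_on' with
  | add p q hp hq => rw [map_add]; exact (le_min hp hq).trans (min_le_mk_add _ _)
  | monomial n r =>
    rw [aeval_monomial, mk_mul, mk_pow]
    exact add_nonneg (mk_algebraMap_real_nonneg r) (nsmul_nonneg hs n)

lemma mk_aeval_eq_zero {s : K} (hs : 0 < mk s) {a : ℝ[X]} (ha : a.coeff 0 ≠ 0) :
    mk (aeval s a) = 0 := by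
  rw [← divX_mul_X_add a, map_add, map_mul, aeval_X, aeval_C]
  have h : mk (aeval s a.divX * s) > mk (algebraMap ℝ K (a.coeff 0)) := by
    rw [mk_algebraMap_real ha, mk_mul]
    exact lt_of_lt_of_le hs (le_add_of_nonneg_left (mk_aeval_nonneg hs.le _))
  rw [mk_add_eq_mk_right h, mk_algebraMap_real ha]

/-- A nonzero real polynomial in an infinitesimal `s` has the class of a power of `s`. -/
lemma exists_mk_aeval_eq {s : K} (hs : 0 < mk s) {a : ℝ[X]} (ha : a ≠ 0) :
    ∃ m ≤ a.natDegree, mk (aeval s a) = mk (s ^ m) := by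
  obtain ⟨b, hb, hb0⟩ := exists_eq_pow_rootMultiplicity_mul_and_not_dvd a ha 0
  refine ⟨rootMultiplicity 0 a, ?_, ?_⟩
  · have hb0 : b ≠ 0 := by rintro rfl; exact hb0 (dvd_zero _)
    have h := congrArg natDegree hb
    rw [natDegree_mul (pow_ne_zero _ (X_sub_C_ne_zero _)) hb0, natDegree_pow, natDegree_X_sub_C] at h
    omega
  have hb0 : b.coeff 0 ≠ 0 := by
    rw [map_zero, sub_zero, X_dvd_iff] at hb0; exact hb0
  conv_lhs => rw [hb]
  rw [map_mul, mk_mul, mk_aeval_eq_zero hs hb0]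
  simp

lemma aeval_ne_zero_of_infinitesimal {s : K} (hs0 : s ≠ 0) (hs : 0 < mk s) {a : ℝ[X]} (ha : a ≠ 0) :
    aeval s a ≠ 0 := by
  obtain ⟨m, -, hm⟩ := exists_mk_aeval_eq hs ha
  intro h
  rw [h, eq_comm, mk_zero, mk_eq_top_iff] at hm
  exact pow_ne_zero _ hs0 hm

lemma exists_eq_real_add (y : K) (hy : 0 ≤ mk y) :
    ∃ (c : ℝ) (u : K), y = algebraMap ℝ K c + u ∧ 0 < mk u := by
  exact ⟨stdPart y, y - algebraMap ℝ K (stdPart y), by ring,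
    mk_sub_stdPart_pos (realOrderHom K) hy⟩

end core

section field
open ArchimedeanClass Polynomial

lemma algebraMap_eq_aeval_X {L : Type*} [CommRing L] [Algebra ℝ L] [Algebra ℝ[X] L]
    [IsScalarTower ℝ ℝ[X] L] (a : ℝ[X]) : algebraMap ℝ[X] L a = aeval (algebraMap ℝ[X] L X) a := by
  have := Polynomial.aeval_algebraMap_apply L (X : ℝ[X]) a
  rw [this]; simp

lemma algebraMap_X_ne_zero {L : Type*} [Field L] [Algebra ℝ[X] L] [Algebra (FractionRing ℝ[X]) L]
    [IsScalarTower ℝ[X] (FractionRing ℝ[X]) L] : algebraMap ℝ[X] L X ≠ 0 := by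
  have : FaithfulSMul ℝ[X] L := FaithfulSMul.trans ℝ[X] (FractionRing ℝ[X]) L
  rw [Ne, FaithfulSMul.algebraMap_eq_zero_iff]
  exact X_ne_zero

variable {L : Type*} [Field L] [LinearOrder L] [IsStrictOrderedRing L] [Algebra ℝ L]
  [Algebra ℝ[X] L] [IsScalarTower ℝ ℝ[X] L] [Algebra (FractionRing ℝ[X]) L]
  [IsScalarTower ℝ[X] (FractionRing ℝ[X]) L]

lemma exists_mk_algebraMap_eq (hs : 0 < mk (algebraMap ℝ[X] L X)) {c : FractionRing ℝ[X]}
    (hc : c ≠ 0) :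
    ∃ m : ℤ, mk (algebraMap (FractionRing ℝ[X]) L c) = mk ((algebraMap ℝ[X] L X) ^ m) := by
  obtain ⟨a, b, hb, rfl⟩ := IsFractionRing.div_surjective (A := ℝ[X]) c
  have hb0 : b ≠ 0 := nonZeroDivisors.ne_zero hb
  have ha0 : a ≠ 0 := by rintro rfl; simp at hc
  have hs0 : algebraMap ℝ[X] L X ≠ 0 := algebraMap_X_ne_zero
  obtain ⟨m, -, hm⟩ := exists_mk_aeval_eq hs ha0
  obtain ⟨k, -, hk⟩ := exists_mk_aeval_eq hs hb0
  refine ⟨m - k, ?_⟩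
  rw [map_div₀, ← IsScalarTower.algebraMap_apply, ← IsScalarTower.algebraMap_apply,
    algebraMap_eq_aeval_X a, algebraMap_eq_aeval_X b, mk_div, hm, hk, zpow_sub₀ hs0, zpow_natCast,
    zpow_natCast, mk_div]

/-- In a finite extension of the rational functions in an infinitesimal `s`, a fixed power of every
nonzero element is a power of `s` up to a finite unit. -/
lemma exists_pow_mul_zpow_mk_eq_zero [FiniteDimensional (FractionRing ℝ[X]) L]
    (hs : 0 < mk (algebraMap ℝ[X] L X)) :
    ∃ M : ℕ, 0 < M ∧ ∀ u : L, u ≠ 0 → ∃ p : ℤ, mk (u ^ M * (algebraMap ℝ[X] L X) ^ p) = 0 := by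
  set s := algebraMap ℝ[X] L X with hsdef
  have hs0 : s ≠ 0 := algebraMap_X_ne_zero
  set N := Module.finrank (FractionRing ℝ[X]) L
  refine ⟨N.factorial, Nat.factorial_pos _, fun u hu => ?_⟩
  set F := FractionRing ℝ[X]
  set μ := minpoly F u with hμ
  have h_integral : IsIntegral F u := IsIntegral.of_finite F u
  have hμ0 : μ ≠ 0 := minpoly.ne_zero h_integral
  have hsum : ∑ i ∈ μ.support, algebraMap F L (μ.coeff i) * u ^ i = 0 := by
    have := minpoly.aeval F u
    rw [aeval_def, eval₂_eq_sum, Polynomial.sum] at this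
    exact this
  have hterm : ∀ i ∈ μ.support, algebraMap F L (μ.coeff i) * u ^ i ≠ 0 := by
    intro i hi
    have : μ.coeff i ≠ 0 := by simpa using hi
    simp [this, hu]
  have hnot : ¬ Set.InjOn (fun i => mk (algebraMap F L (μ.coeff i) * u ^ i)) μ.support := by
    intro h
    obtain ⟨i, hi, h1⟩ := exists_mk_sum_eq _ _ (by simpa using hμ0) h
    rw [hsum, mk_zero, eq_comm, mk_eq_top_iff] at h1
    exact hterm i hi h1
  have key : ∃ i ∈ μ.support, ∃ j ∈ μ.support, i < j ∧
      mk (algebraMap F L (μ.coeff i) * u ^ i) = mk (algebraMap F L (μ.coeff j) * u ^ j) := by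
    simp only [Set.InjOn] at hnot
    push Not at hnot
    obtain ⟨i, hi, j, hj, h, hij⟩ := hnot
    rcases lt_or_gt_of_ne hij with h' | h'
    · exact ⟨i, hi, j, hj, h', h⟩
    · exact ⟨j, hj, i, hi, h', h.symm⟩
  obtain ⟨i, hi, j, hj, hij, h⟩ := key
  obtain ⟨a, ha⟩ := exists_mk_algebraMap_eq (L := L) hs (c := μ.coeff i) (by simpa using hi)
  obtain ⟨b, hb⟩ := exists_mk_algebraMap_eq (L := L) hs (c := μ.coeff j) (by simpa using hj)
  rw [← hsdef] at ha hb
  have h0 : mk (u ^ (j - i) * s ^ (b - a)) = 0 := by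
    rw [mk_mul, mk_mul, ha, hb] at h
    have e : u ^ (j - i) * s ^ (b - a) = (s ^ b * u ^ j) / (s ^ a * u ^ i) := by
      rw [zpow_sub₀ hs0, pow_sub₀ u hu hij.le]; field_simp
    rw [e, mk_div, mk_mul, mk_mul, h]
    rw [← mk_mul, LinearOrderedAddCommGroupWithTop.sub_self_eq_zero_iff_ne_top, Ne, mk_eq_top_iff]
    exact mul_ne_zero (zpow_ne_zero _ hs0) (pow_ne_zero _ hu)
  have hjN : j ≤ N := (le_natDegree_of_mem_supp _ hj).trans (minpoly.natDegree_le u)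
  obtain ⟨r, hr⟩ : (j - i) ∣ N.factorial := Nat.dvd_factorial (by omega) (by omega)
  refine ⟨(b - a) * r, ?_⟩
  rw [hr, pow_mul, zpow_mul, zpow_natCast, ← mul_pow, mk_pow, h0, nsmul_zero]

end field

section field
open ArchimedeanClass Polynomial

variable {L : Type*} [Field L] [LinearOrder L] [IsStrictOrderedRing L] [Algebra ℝ L]
  [Algebra ℝ[X] L] [IsScalarTower ℝ ℝ[X] L]

lemma mk_nonneg_of_isIntegral (hs : 0 < mk (algebraMap ℝ[X] L X)) {b : L}
    (hb : IsIntegral ℝ[X] b) : 0 ≤ mk b := by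
  let v := (addValuation L).toValuation
  have hv : v.Integers v.integer := Valuation.integer.integers v
  let g : ℝ[X] →+* v.integer := (algebraMap ℝ[X] L).codRestrict v.integer (by
    intro a
    change 0 ≤ mk (algebraMap ℝ[X] L a)
    rw [algebraMap_eq_aeval_X]
    exact mk_aeval_nonneg hs.le a)
  obtain ⟨p, hp, hp0⟩ := hb
  have : b ∈ v.integer := hv.mem_of_integral ⟨p.map g, hp.map g, by
    rw [eval₂_map]; exact hp0⟩
  exact this

variable [Algebra (FractionRing ℝ[X]) L] [IsScalarTower ℝ[X] (FractionRing ℝ[X]) L]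
  [FiniteDimensional (FractionRing ℝ[X]) L]

/-- The finite elements are fractions of integral elements with non-infinitesimal denominator. -/
lemma exists_integral_div (hs : 0 < mk (algebraMap ℝ[X] L X)) {y : L} (hy : 0 ≤ mk y) :
    ∃ a b : L, IsIntegral ℝ[X] a ∧ IsIntegral ℝ[X] b ∧ mk b = 0 ∧ y = a / b := by
  let F := FractionRing ℝ[X]
  let B := integralClosure ℝ[X] L
  have hB : ∀ b : B, 0 ≤ mk (b : L) := fun b => mk_nonneg_of_isIntegral hs b.2
  have : IsDedekindDomain B := IsIntegralClosure.isDedekindDomain ℝ[X] F L B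
  have : IsFractionRing B L := integralClosure.isFractionRing_of_finite_extension F L
  let 𝔭 : Ideal B :=
    { carrier := {b | 0 < mk (b : L)}
      add_mem' := by
        intro a b ha hb
        exact lt_of_lt_of_le (lt_min (Set.mem_ofPred.1 ha) (Set.mem_ofPred.1 hb)) (min_le_mk_add _ _)
      zero_mem' := by simp
      smul_mem' := by
        intro c b hb
        change 0 < mk ((c : L) * (b : L))
        rw [mk_mul]
        exact lt_of_lt_of_le hb (le_add_of_nonneg_left (hB c)) }
  have hmem : ∀ b : B, b ∉ 𝔭 ↔ mk (b : L) = 0 := fun b => by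
    change ¬ (0 < mk (b : L)) ↔ _
    rw [not_lt]
    exact ⟨fun h => le_antisymm h (hB b), fun h => h.le⟩
  have : 𝔭.IsPrime := by
    refine ⟨?_, ?_⟩
    · rw [Ideal.ne_top_iff_one, hmem]; simp
    · intro a b hab
      by_contra! h
      rw [hmem, hmem] at h
      have h2 : a * b ∉ 𝔭 := by
        rw [hmem]
        change mk ((a : L) * (b : L)) = 0
        rw [mk_mul, h.1, h.2, add_zero]
      exact h2 hab
  have hbot : 𝔭 ≠ ⊥ := by
    intro h
    have : algebraMap ℝ[X] B X ∈ 𝔭 := hs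
    rw [h, Ideal.mem_bot] at this
    have h2 : algebraMap ℝ[X] L X = 0 := congrArg (fun b : B => (b : L)) this
    exact algebraMap_X_ne_zero h2
  have hS : 𝔭.primeCompl ≤ nonZeroDivisors B := Ideal.primeCompl_le_nonZeroDivisors 𝔭
  let R := Localization.subalgebra.ofField L 𝔭.primeCompl hS
  have : IsLocalization.AtPrime R 𝔭 :=
    Localization.subalgebra.isLocalization_ofField L 𝔭.primeCompl hS
  have : IsFractionRing R L := Localization.subalgebra.isFractionRing_ofField L 𝔭.primeCompl hS
  have := IsLocalization.AtPrime.isDiscreteValuationRing_of_dedekind_domain B hbot R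
  by_cases hy0 : y = 0
  · exact ⟨0, 1, isIntegral_zero, isIntegral_one, by simp, by simp [hy0]⟩
  rcases ValuationRing.isInteger_or_isInteger R y with h | h
  · obtain ⟨⟨x, a, b, hb, hx⟩, rfl⟩ := h
    exact ⟨a, b, a.2, b.2, (hmem b).1 hb, by rw [div_eq_mul_inv]; exact hx⟩
  · obtain ⟨⟨x, a, b, hb, hx⟩, hxy⟩ := h
    have hb0 : mk (b : L) = 0 := (hmem b).1 hb
    have hxy' : (a : L) * (b : L)⁻¹ = y⁻¹ := hx.symm.trans hxy
    have hbne : (b : L) ≠ 0 := by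
      intro h; rw [h, mk_zero] at hb0; exact LinearOrderedAddCommGroupWithTop.top_ne_zero hb0
    have hane : (a : L) ≠ 0 := by
      intro h; rw [h, zero_mul, eq_comm, inv_eq_zero] at hxy'; exact hy0 hxy'
    have hya : (b : L) = y * a := by field_simp at hxy'; rw [← hxy']; ring
    refine ⟨b, a, b.2, a.2, ?_, by rw [hya]; field_simp⟩
    have := congrArg mk hya
    rw [hb0, mk_mul] at this
    refine le_antisymm ?_ (hB a)
    rw [this]
    exact le_add_of_nonneg_left hy

/-- Every element of `L` becomes finite after multiplication with a power of `s`. -/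
lemma exists_pow_mul_mk_nonneg (hs : 0 < mk (algebraMap ℝ[X] L X)) (u : L) :
    ∃ N : ℕ, 0 ≤ mk ((algebraMap ℝ[X] L X) ^ N * u) := by
  obtain ⟨M, hM, h⟩ := exists_pow_mul_zpow_mk_eq_zero (L := L) hs
  have hs0 : algebraMap ℝ[X] L X ≠ 0 := algebraMap_X_ne_zero
  set s := algebraMap ℝ[X] L X
  by_cases hu : u = 0
  · exact ⟨0, by simp [hu]⟩
  obtain ⟨p, hp⟩ := h u hu
  refine ⟨p.toNat, ?_⟩
  have h1 : 0 ≤ mk ((s ^ p.toNat * u) ^ M) := by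
    have e : (s ^ p.toNat * u) ^ M = (u ^ M * s ^ p) * s ^ (p.toNat * (M - 1)) * s ^ ((p.toNat : ℤ) - p).toNat := by
      have : s ^ ((p.toNat : ℤ) - p).toNat = s ^ ((p.toNat : ℤ) - p) := by
        rw [← zpow_natCast, Int.toNat_of_nonneg (by omega)]
      rw [this, zpow_sub₀ hs0, mul_pow, ← pow_mul, zpow_natCast]
      obtain ⟨m, rfl⟩ : ∃ m, M = m + 1 := ⟨M - 1, by omega⟩
      have := zpow_ne_zero p hs0
      field_simp
      simp only [Nat.add_sub_cancel]
      ring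
    rw [e, mk_mul, mk_mul, hp, zero_add, mk_pow, mk_pow]
    exact add_nonneg (nsmul_nonneg hs.le _) (nsmul_nonneg hs.le _)
  rw [mk_pow] at h1
  by_contra! h2
  exact absurd h1 (not_le.2 (by
    obtain ⟨m, rfl⟩ : ∃ m, M = m + 1 := ⟨M - 1, by omega⟩
    rw [succ_nsmul]
    exact lt_of_le_of_lt (add_le_of_nonpos_left (nsmul_nonpos h2.le m)) h2))

end field

section field
open ArchimedeanClass Polynomial

variable {L : Type*} [Field L] [LinearOrder L] [IsStrictOrderedRing L] [Algebra ℝ L]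
  [Algebra ℝ[X] L] [IsScalarTower ℝ ℝ[X] L]
  [Algebra (FractionRing ℝ[X]) L] [IsScalarTower ℝ[X] (FractionRing ℝ[X]) L]
  [FiniteDimensional (FractionRing ℝ[X]) L]

lemma exists_pow_mul_derivation_integral_nonneg (hs : 0 < mk (algebraMap ℝ[X] L X))
    (D : Derivation ℝ L L) (hD : D (algebraMap ℝ[X] L X) = algebraMap ℝ[X] L X) :
    ∃ N : ℕ, ∀ b : L, IsIntegral ℝ[X] b → 0 ≤ mk ((algebraMap ℝ[X] L X) ^ N * D b) := by
  classical
  let B := integralClosure ℝ[X] L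
  have hfin : Module.Finite ℝ[X] B := IsIntegralClosure.finite ℝ[X] (FractionRing ℝ[X]) L B
  obtain ⟨S, hS⟩ := hfin.fg_top
  choose N hN using fun b : B => exists_pow_mul_mk_nonneg hs (D (b : L))
  refine ⟨S.sup N, fun b hb => ?_⟩
  have hs0 : 0 ≤ mk (algebraMap ℝ[X] L X) := hs.le
  have hmem : (⟨b, hb⟩ : B) ∈ Submodule.span ℝ[X] (S : Set B) := by rw [hS]; trivial
  suffices h : ∀ b : B, b ∈ Submodule.span ℝ[X] (S : Set B) →
      0 ≤ mk ((algebraMap ℝ[X] L X) ^ (S.sup N) * D (b : L)) from h _ hmem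
  intro b hb
  induction hb using Submodule.span_induction with
  | mem b hb =>
    have h1 : N b ≤ S.sup N := Finset.le_sup (f := N) hb
    have e : (algebraMap ℝ[X] L X) ^ (S.sup N) * D (b : L) =
        (algebraMap ℝ[X] L X) ^ (S.sup N - N b) * ((algebraMap ℝ[X] L X) ^ N b * D (b : L)) := by
      rw [← mul_assoc, ← pow_add, Nat.sub_add_cancel h1]
    rw [e]
    exact mk_mul_nonneg (mk_pow_nonneg hs0 _) (hN b)
  | zero => simp
  | add a b _ _ ha hb =>
    have e : ((a + b : B) : L) = a + b := rfl
    rw [e, map_add, mul_add]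
    exact mk_add_nonneg ha hb
  | smul p b _ hb =>
    have e : ((p • b : B) : L) = aeval (algebraMap ℝ[X] L X) p * b := by
      rw [← algebraMap_eq_aeval_X, ← Algebra.smul_def]; rfl
    rw [e, D.leibniz, Derivation.map_aeval, hD, smul_eq_mul, smul_eq_mul, smul_eq_mul, mul_add]
    have e1 : ∀ a b c : L, a * (b * c) = b * (a * c) := fun a b c => by ring
    refine mk_add_nonneg ?_ ?_
    · rw [e1]
      exact mk_mul_nonneg (mk_aeval_nonneg hs0 _) hb
    · exact mk_mul_nonneg (mk_pow_nonneg hs0 _) (mk_mul_nonneg (mk_nonneg_of_isIntegral hs b.2)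
        (mk_mul_nonneg (mk_aeval_nonneg hs0 _) hs0))

lemma exists_pow_mul_derivation_nonneg (hs : 0 < mk (algebraMap ℝ[X] L X))
    (D : Derivation ℝ L L) (hD : D (algebraMap ℝ[X] L X) = algebraMap ℝ[X] L X) :
    ∃ N : ℕ, ∀ y : L, 0 ≤ mk y → 0 ≤ mk ((algebraMap ℝ[X] L X) ^ N * D y) := by
  obtain ⟨N, hN⟩ := exists_pow_mul_derivation_integral_nonneg hs D hD
  refine ⟨N, fun y hy => ?_⟩
  obtain ⟨a, b, ha, hb, hb0, rfl⟩ := exists_integral_div hs hy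
  have hbinv : 0 ≤ mk b⁻¹ := by rw [mk_inv, hb0, neg_zero]
  have e : (algebraMap ℝ[X] L X) ^ N * D (a / b) = b⁻¹ ^ 2 * (b * ((algebraMap ℝ[X] L X) ^ N * D a)
      + (-a) * ((algebraMap ℝ[X] L X) ^ N * D b)) := by
    rw [Derivation.leibniz_div]
    simp only [smul_eq_mul]
    ring
  rw [e]
  refine mk_mul_nonneg (mk_pow_nonneg hbinv _) (mk_add_nonneg ?_ ?_)
  · exact mk_mul_nonneg hb0.ge (hN a ha)
  · exact mk_mul_nonneg (by rw [mk_neg]; exact mk_nonneg_of_isIntegral hs ha) (hN b hb)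

/-- Logarithmic derivative of an infinitesimal, in terms of a finite unit `e`. -/
lemma exists_derivation_eq_mul (hs : 0 < mk (algebraMap ℝ[X] L X))
    (D : Derivation ℝ L L) (hD : D (algebraMap ℝ[X] L X) = algebraMap ℝ[X] L X) :
    ∃ M : ℕ, 0 < M ∧ ∀ u : L, u ≠ 0 → 0 < mk u → ∃ (k : ℕ) (e : L), mk e = 0 ∧
      u ^ M = e * (algebraMap ℝ[X] L X) ^ (k + 1) ∧
      D u = u * (M : L)⁻¹ * (D e * e⁻¹ + ((k + 1 : ℕ) : L)) := by
  obtain ⟨M, hM, h⟩ := exists_pow_mul_zpow_mk_eq_zero (L := L) hs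
  have hs0 : algebraMap ℝ[X] L X ≠ 0 := algebraMap_X_ne_zero
  set s := algebraMap ℝ[X] L X
  refine ⟨M, hM, fun u hu hu0 => ?_⟩
  obtain ⟨p, hp⟩ := h u hu
  have hp0 : p < 0 := by
    by_contra! hp0
    lift p to ℕ using hp0
    rw [zpow_natCast, mk_mul] at hp
    have h1 : 0 < mk (u ^ M) := by
      obtain ⟨m, rfl⟩ : ∃ m, M = m + 1 := ⟨M - 1, by omega⟩
      rw [mk_pow, succ_nsmul]
      exact lt_of_lt_of_le hu0 (le_add_of_nonneg_left (nsmul_nonneg hu0.le m))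
    have h2 : 0 ≤ mk (s ^ p) := mk_pow_nonneg hs.le p
    exact (lt_of_lt_of_le h1 (le_add_of_nonneg_right h2)).ne' hp
  obtain ⟨k, rfl⟩ : ∃ k : ℕ, p = -((k + 1 : ℕ) : ℤ) := ⟨(-p).toNat - 1, by omega⟩
  refine ⟨k, u ^ M * s ^ (-((k + 1 : ℕ) : ℤ)), hp, ?_, ?_⟩
  · rw [zpow_neg, zpow_natCast]; field_simp
  set e := u ^ M * s ^ (-((k + 1 : ℕ) : ℤ)) with he
  have he0 : e ≠ 0 := mul_ne_zero (pow_ne_zero _ hu) (zpow_ne_zero _ hs0)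
  have hM0 : (M : L) ≠ 0 := by exact_mod_cast hM.ne'
  have hue : u ^ M = e * s ^ (k + 1) := by
    rw [he, zpow_neg, zpow_natCast]; field_simp
  have h3 := congrArg D hue
  rw [D.leibniz, D.leibniz_pow, D.leibniz_pow, hD] at h3
  simp only [smul_eq_mul, nsmul_eq_mul, Nat.add_sub_cancel] at h3
  obtain ⟨m, rfl⟩ : ∃ m, M = m + 1 := ⟨M - 1, by omega⟩
  simp only [Nat.add_sub_cancel] at h3
  have hum : u ^ m ≠ 0 := pow_ne_zero _ hu
  have h4 : ((m + 1 : ℕ) : L) * u ^ (m + 1) * D u = u * (u ^ (m + 1) * (D e * e⁻¹ + ((k + 1 : ℕ) : L))) := by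
    have : ((m + 1 : ℕ) : L) * u ^ (m + 1) * D u = u * (((m + 1 : ℕ) : L) * (u ^ m * D u)) := by ring
    rw [this, h3, hue]
    field_simp
    ring
  have hum' : u ^ (m + 1) ≠ 0 := pow_ne_zero _ hu
  have h5 : ((m + 1 : ℕ) : L) * D u = u * (D e * e⁻¹ + ((k + 1 : ℕ) : L)) := by
    apply mul_left_cancel₀ hum'
    linear_combination h4
  rw [eq_comm, mul_right_comm, ← h5]
  field_simp

/-- The derivation `s d/ds` preserves finite elements. -/
lemma mk_derivation_nonneg (hs : 0 < mk (algebraMap ℝ[X] L X))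
    (D : Derivation ℝ L L) (hD : D (algebraMap ℝ[X] L X) = algebraMap ℝ[X] L X) {y : L}
    (hy : 0 ≤ mk y) : 0 ≤ mk (D y) := by
  obtain ⟨M, hM, hu⟩ := exists_derivation_eq_mul hs D hD
  obtain ⟨N₀, hN₀⟩ := exists_pow_mul_derivation_nonneg hs D hD
  have hs0 : algebraMap ℝ[X] L X ≠ 0 := algebraMap_X_ne_zero
  set s := algebraMap ℝ[X] L X
  have hM0 : (M : L) ≠ 0 := by exact_mod_cast hM.ne'
  have hMinv : mk (M : L)⁻¹ = 0 := by rw [mk_inv, mk_natCast hM.ne', neg_zero]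
  have hpow_succ : ∀ N : ℕ, (∀ y : L, 0 ≤ mk y → 0 ≤ mk (s ^ (N + 1) * (D y) ^ M)) →
      ∀ y : L, 0 ≤ mk y → 0 ≤ mk (s ^ N * (D y) ^ M) := by
    intro N hN y hy
    obtain ⟨c, u, rfl, hu0⟩ := exists_eq_real_add y hy
    rw [map_add, D.map_algebraMap, zero_add]
    by_cases hune : u = 0
    · simp [hune, hM.ne']
    obtain ⟨k, e, he, hue, hDu⟩ := hu u hune hu0
    have h1 := hN e he.ge
    set w := D e * e⁻¹ + ((k + 1 : ℕ) : L) with hw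
    have hmw : min (mk (D e)) 0 ≤ mk w := by
      refine le_trans (min_le_min ?_ (mk_natCast_nonneg (k + 1))) (min_le_mk_add _ _)
      rw [mk_mul, mk_inv, he, neg_zero, add_zero]
    have h2 : 0 ≤ mk (s ^ (N + 1) * w ^ M) := by
      rcases min_le_iff.1 hmw with h | h
      · rw [mk_mul, mk_pow _ w] 
        rw [mk_mul, mk_pow _ (D e)] at h1
        exact h1.trans (add_le_add le_rfl (nsmul_le_nsmul_right h M))
      · exact mk_mul_nonneg (mk_pow_nonneg hs.le _) (mk_pow_nonneg h _)
    have e1 : s ^ N * D u ^ M = e * s ^ k * (M : L)⁻¹ ^ M * (s ^ (N + 1) * w ^ M) := by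
      rw [hDu, mul_pow, mul_pow, hue]; ring
    rw [e1]
    exact mk_mul_nonneg (mk_mul_nonneg (mk_mul_nonneg he.ge (mk_pow_nonneg hs.le _))
      (mk_pow_nonneg hMinv.ge _)) h2
  have h0 : ∀ N : ℕ, (∀ y : L, 0 ≤ mk y → 0 ≤ mk (s ^ N * (D y) ^ M)) →
      ∀ y : L, 0 ≤ mk y → 0 ≤ mk ((D y) ^ M) := by
    intro N
    induction N with
    | zero => intro h; simpa using h
    | succ N ih => intro h; exact ih (hpow_succ N h)
  refine mk_nonneg_of_pow hM (h0 (N₀ * M) (fun y hy => ?_) y hy)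
  rw [pow_mul, ← mul_pow]
  exact mk_pow_nonneg (hN₀ y hy) M

/-- The derivation `s d/ds` does not decrease the order of an infinitesimal. -/
lemma mk_le_mk_derivation (hs : 0 < mk (algebraMap ℝ[X] L X))
    (D : Derivation ℝ L L) (hD : D (algebraMap ℝ[X] L X) = algebraMap ℝ[X] L X) {u : L}
    (hu : 0 < mk u) : mk u ≤ mk (D u) := by
  obtain ⟨M, hM, h⟩ := exists_derivation_eq_mul hs D hD
  by_cases hune : u = 0
  · simp [hune]
  obtain ⟨k, e, he, hue, hDu⟩ := h u hune hu
  have hMinv : mk (M : L)⁻¹ = 0 := by rw [mk_inv, mk_natCast hM.ne', neg_zero]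
  rw [hDu, mul_assoc, mk_mul]
  refine le_add_of_nonneg_right (mk_mul_nonneg hMinv.ge (mk_add_nonneg (mk_mul_nonneg ?_ ?_)
    (mk_natCast_nonneg _)))
  · exact mk_derivation_nonneg hs D hD he.ge
  · rw [mk_inv, he, neg_zero]

end field

section
open Polynomial TensorProduct

/-- Every algebraic extension of the rational function field carries the derivation `s d/ds`. -/
lemma exists_derivation_X (L : Type*) [Field L] [Algebra ℝ L]
    [Algebra ℝ[X] L] [IsScalarTower ℝ ℝ[X] L]
    [Algebra (FractionRing ℝ[X]) L] [IsScalarTower ℝ[X] (FractionRing ℝ[X]) L]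
    [FiniteDimensional (FractionRing ℝ[X]) L] :
    ∃ D : Derivation ℝ L L, D (algebraMap ℝ[X] L X) = algebraMap ℝ[X] L X := by
  have h1 : Algebra.FormallyEtale ℝ[X] (FractionRing ℝ[X]) :=
    Algebra.FormallyEtale.of_isLocalization (nonZeroDivisors ℝ[X])
  have h2 : Algebra.FormallyEtale (FractionRing ℝ[X]) L :=
    Algebra.FormallyEtale.of_isSeparable _ _
  have h3 : Algebra.FormallyEtale ℝ[X] L := Algebra.FormallyEtale.comp ℝ[X] (FractionRing ℝ[X]) L
  let s := algebraMap ℝ[X] L X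
  let d : Derivation ℝ ℝ[X] L := mkDerivation ℝ s
  let g : L ⊗[ℝ[X]] Ω[ℝ[X]⁄ℝ] →ₗ[L] L := d.liftKaehlerDifferential.liftBaseChange L
  let e := KaehlerDifferential.tensorKaehlerEquivOfFormallyEtale ℝ ℝ[X] L
  refine ⟨(g ∘ₗ e.symm.toLinearMap).compDer (KaehlerDifferential.D ℝ L), ?_⟩
  change g (e.symm (KaehlerDifferential.D ℝ L (algebraMap ℝ[X] L X))) = _
  rw [KaehlerDifferential.tensorKaehlerEquivOfFormallyEtale_symm_D_algebraMap]
  simp [g, d, s]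
end

lemma derivation_aeval_mvPolynomial {σ R A : Type*} [Fintype σ] [CommRing R] [CommRing A]
    [Algebra R A] (D : Derivation R A A) (x : σ → A) (P : MvPolynomial σ R) :
    D (MvPolynomial.aeval x P) = ∑ i, MvPolynomial.aeval x (MvPolynomial.pderiv i P) * D (x i) := by
  classical
  induction P using MvPolynomial.induction_on with
  | C a => simp
  | add p q hp hq => simp [hp, hq, add_mul, Finset.sum_add_distrib]
  | mul_X p j hp =>
    simp only [map_mul, D.leibniz, hp, MvPolynomial.aeval_X, smul_eq_mul, Derivation.leibniz,
      MvPolynomial.pderiv_X, map_add, add_mul, Finset.sum_add_distrib, Finset.mul_sum]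
    congr 1
    · rw [Finset.sum_eq_single j]
      · simp
      · intro b _ hb
        simp [hb.symm]
      · simp
    · exact Finset.sum_congr rfl fun i _ => by ring

section
open ArchimedeanClass Polynomial

variable {K : Type*} [Field K] [LinearOrder K] [IsStrictOrderedRing K] [Algebra ℝ K]

lemma mk_le_mk_eval₂_sub {s x : K} (hs : 0 ≤ mk s) (hx : 0 ≤ mk x) (Q : ℝ[X][X]) :
    mk s ≤ mk (Q.eval₂ (aeval s : ℝ[X] →ₐ[ℝ] K).toRingHom x
      - aeval x (Q.map (evalRingHom 0))) := by
  induction Q using Polynomial.induction_on' with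
  | add p q hp hq =>
    rw [eval₂_add, Polynomial.map_add, map_add, add_sub_add_comm]
    exact (le_min hp hq).trans (min_le_mk_add _ _)
  | monomial n a =>
    rw [eval₂_monomial, map_monomial, aeval_monomial, ← sub_mul]
    have e : (aeval s : ℝ[X] →ₐ[ℝ] K).toRingHom a - algebraMap ℝ K (evalRingHom 0 a)
        = s * aeval s a.divX := by
      change aeval s a - _ = _
      have h := congrArg (aeval s) (divX_mul_X_add a)
      rw [map_add, map_mul, aeval_X, aeval_C] at h
      rw [← h, coe_evalRingHom, ← coeff_zero_eq_eval_zero]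
      ring
    rw [e, mul_assoc, mk_mul s]
    exact le_add_of_nonneg_right (mk_mul_nonneg (mk_aeval_nonneg hs _) (mk_pow_nonneg hx _))

/-- An infinitesimal `u` such that `c + u` is a root of a polynomial of degree at most `q` over
`ℝ[s]` satisfies `|u| ^ q = O(s)`. -/
lemma mk_le_nsmul_mk_of_root {s : K} (hs0 : s ≠ 0) (hs : 0 < mk s) {c : ℝ} {u : K} (hu : 0 < mk u)
    {Q : ℝ[X][X]} (hQ : Q ≠ 0) {q : ℕ} (hq : Q.natDegree ≤ q)
    (hroot : Q.eval₂ (aeval s : ℝ[X] →ₐ[ℝ] K).toRingHom (algebraMap ℝ K c + u) = 0) :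
    mk s ≤ q • mk u := by
  have hX : ¬ IsUnit (C X : ℝ[X][X]) := by
    rw [isUnit_C]; exact not_isUnit_X
  obtain ⟨m, Q', rfl, hQ'⟩ : ∃ m Q', Q = (C X : ℝ[X][X]) ^ m * Q' ∧ ¬ (C X : ℝ[X][X]) ∣ Q' := by
    obtain ⟨Q', h1, h2⟩ := (FiniteMultiplicity.of_not_isUnit hX hQ).exists_eq_pow_mul_and_not_dvd
    exact ⟨_, Q', h1, h2⟩
  have hR0 : Q'.map (evalRingHom 0) ≠ 0 := by
    intro h
    apply hQ'
    rw [C_dvd_iff_dvd_coeff]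
    intro i
    rw [X_dvd_iff, coeff_zero_eq_eval_zero]
    have := congrArg (fun p => coeff p i) h
    simpa using this
  have hdeg : (Q'.map (evalRingHom 0)).natDegree ≤ q := by
    refine natDegree_map_le.trans (le_trans ?_ hq)
    rw [← C_pow, natDegree_C_mul (pow_ne_zero _ X_ne_zero)]
  rw [eval₂_mul, eval₂_pow, eval₂_C] at hroot
  have hroot' : Q'.eval₂ (aeval s : ℝ[X] →ₐ[ℝ] K).toRingHom (algebraMap ℝ K c + u) = 0 := by
    refine (mul_eq_zero.1 hroot).resolve_left (pow_ne_zero _ ?_)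
    change aeval s X ≠ 0
    rwa [aeval_X]
  have hx : 0 ≤ mk (algebraMap ℝ K c + u) := mk_add_nonneg (mk_algebraMap_real_nonneg c) hu.le
  have h1 := mk_le_mk_eval₂_sub hs.le hx Q'
  rw [hroot', zero_sub, mk_neg] at h1
  set R := Q'.map (evalRingHom 0)
  have h2 : aeval (algebraMap ℝ K c + u) R = aeval u (R.comp (X + C c)) := by
    rw [aeval_comp]; simp [add_comm]
  have h3 : R.comp (X + C c) ≠ 0 := by
    intro h
    rcases comp_eq_zero_iff.1 h with h | h
    · exact hR0 h
    · have := congrArg natDegree h.2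
      rw [natDegree_X_add_C] at this
      simp at this
  obtain ⟨b, hb, hb'⟩ := exists_mk_aeval_eq hu h3
  rw [h2, hb', mk_pow] at h1
  refine h1.trans (nsmul_le_nsmul_left hu.le (hb.trans ?_))
  rw [natDegree_comp, natDegree_X_add_C, mul_one]
  exact hdeg
end

section
open ArchimedeanClass Polynomial
lemma false_of_algebraic_infinitesimal_point_aux {L : Type*} [Field L] [LinearOrder L] [IsStrictOrderedRing L]
    [Algebra ℝ L] [Algebra ℝ[X] L] [IsScalarTower ℝ ℝ[X] L]
    [Algebra (FractionRing ℝ[X]) L] [IsScalarTower ℝ[X] (FractionRing ℝ[X]) L]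
    [FiniteDimensional (FractionRing ℝ[X]) L]
    {n : ℕ} {s y G u : L} {x : Fin n → L} (hs : 0 < mk s) (hsX : algebraMap ℝ[X] L X = s)
    (hx : ∀ i, 0 ≤ mk (x i)) (hu : 0 ≤ mk u) (hy : y = s + s ^ 2 * u)
    {Q : Fin n → ℝ[X][X]} (hQ : ∀ i, Q i ≠ 0) {q κ : ℕ} (hq : ∀ i, (Q i).natDegree ≤ q)
    (hqκ : q < κ)
    (hroot : ∀ i, (Q i).eval₂ (aeval s : ℝ[X] →ₐ[ℝ] L).toRingHom (x i) = 0)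
    {P : MvPolynomial (Fin (n + 1)) ℝ}
    (hP : MvPolynomial.aeval (Fin.snoc x y : Fin (n + 1) → L) P = 0)
    (hPy : MvPolynomial.aeval (Fin.snoc x y : Fin (n + 1) → L) (MvPolynomial.pderiv (Fin.last n) P) ≠ 0)
    (hG : ∀ i : Fin n, mk G + mk (MvPolynomial.aeval (Fin.snoc x y : Fin (n + 1) → L)
        (MvPolynomial.pderiv (Fin.last n) P)) ≤
      mk (MvPolynomial.aeval (Fin.snoc x y : Fin (n + 1) → L) (MvPolynomial.pderiv i.castSucc P)))
    (hGs : (κ - 1) • mk s ≤ κ • mk G) : False := by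
  obtain ⟨D, hD⟩ := exists_derivation_X L
  have hs' : 0 < mk (algebraMap ℝ[X] L X) := by rwa [hsX]
  have hs0 : s ≠ 0 := by rw [← hsX]; exact algebraMap_X_ne_zero
  set Py := MvPolynomial.aeval (Fin.snoc x y : Fin (n + 1) → L) (MvPolynomial.pderiv (Fin.last n) P)
  have hchain := derivation_aeval_mvPolynomial D (Fin.snoc x y : Fin (n + 1) → L) P
  rw [hP, map_zero, Fin.sum_univ_castSucc] at hchain
  simp only [Fin.snoc_castSucc, Fin.snoc_last] at hchain
  have hDy : mk (D y) = mk s := by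
    have hDs : D s = s := by rw [← hsX]; exact hD
    have e : D y = s + s * (s * (2 * u + D u)) := by
      rw [hy, map_add, D.leibniz, D.leibniz_pow, hDs]
      simp only [smul_eq_mul, nsmul_eq_mul]
      norm_num
      ring
    rw [e]
    apply mk_add_eq_mk_left
    have h1 : 0 < mk (s * (2 * u + D u)) := by
      rw [mk_mul]
      refine lt_of_lt_of_le hs (le_add_of_nonneg_right (mk_add_nonneg (mk_mul_nonneg ?_ hu)
        (mk_derivation_nonneg hs' D hD hu)))
      rw [mk_ofNat]
    rw [mk_mul]
    have : mk s ≠ ⊤ := by rwa [Ne, mk_eq_top_iff]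
    rw [add_comm]
    conv_lhs => rw [← zero_add (mk s)]
    exact (add_lt_add_iff_left_of_ne_top this).2 h1
  have hs_ne_top : mk s ≠ ⊤ := by rwa [Ne, mk_eq_top_iff]
  have hPytop : mk Py ≠ ⊤ := by rwa [Ne, mk_eq_top_iff]
  have key : ∃ i : Fin n, mk G + mk (D (x i)) ≤ mk s := by
    by_contra! hcon
    have h1 : ∀ i : Fin n, mk s + mk Py < mk (MvPolynomial.aeval (Fin.snoc x y : Fin (n + 1) → L)
        (MvPolynomial.pderiv i.castSucc P) * D (x i)) := by
      intro i
      rw [mk_mul]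
      refine lt_of_lt_of_le ?_ (add_le_add (hG i) le_rfl)
      rw [add_right_comm]
      exact (add_lt_add_iff_left_of_ne_top hPytop).2 (hcon i)
    have h2 : mk s + mk Py < mk (∑ i : Fin n, MvPolynomial.aeval (Fin.snoc x y : Fin (n + 1) → L)
        (MvPolynomial.pderiv i.castSucc P) * D (x i)) := by
      refine Finset.sum_induction _ (fun a => mk s + mk Py < mk a)
        (fun a b ha hb => lt_of_lt_of_le (lt_min ha hb) (min_le_mk_add _ _)) ?_ fun i _ => h1 i
      rw [mk_zero, ← mk_mul, lt_top_iff_ne_top, Ne, mk_eq_top_iff]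
      exact mul_ne_zero hs0 hPy
    have h3 : (∑ i : Fin n, MvPolynomial.aeval (Fin.snoc x y : Fin (n + 1) → L)
        (MvPolynomial.pderiv i.castSucc P) * D (x i)) = - (Py * D y) := by
      linear_combination -hchain
    rw [h3, mk_neg, mk_mul, hDy, add_comm] at h2
    exact lt_irrefl _ h2
  obtain ⟨i, hi⟩ := key
  obtain ⟨c, w, hxi, hw⟩ := exists_eq_real_add (x i) (hx i)
  have hDx : D (x i) = D w := by rw [hxi, map_add, D.map_algebraMap, zero_add]
  have hw1 : mk w ≤ mk (D (x i)) := by rw [hDx]; exact mk_le_mk_derivation hs' D hD hw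
  have hw2 : mk s ≤ q • mk w :=
    mk_le_nsmul_mk_of_root hs0 hs hw (hQ i) (hq i) (by rw [← hxi]; exact hroot i)
  have h4 : κ • mk G + κ • mk w ≤ κ • mk s := by
    rw [← nsmul_add]
    exact nsmul_le_nsmul_right ((add_le_add le_rfl hw1).trans hi) κ
  obtain ⟨l, rfl⟩ : ∃ l, κ = l + 1 := ⟨κ - 1, by omega⟩
  have h5 : l • mk s + (l + 1) • mk w ≤ l • mk s + mk s := by
    rw [← succ_nsmul]
    exact (add_le_add (by simpa using hGs) le_rfl).trans h4
  have hltop : l • mk s ≠ ⊤ := by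
    rw [← mk_pow, Ne, mk_eq_top_iff]; exact pow_ne_zero _ hs0
  have h6 : (l + 1) • mk w ≤ mk s :=
    (add_le_add_iff_right_of_ne_top hltop).1 h5
  have hw0 : mk w ≠ ⊤ := by
    intro h
    rw [mk_eq_top_iff] at h
    rw [← mk_pow, h, zero_pow (by omega), mk_zero, top_le_iff] at h6
    exact hs_ne_top h6
  have h7 : mk s + mk w ≤ mk s := by
    refine le_trans ?_ h6
    rw [succ_nsmul]
    exact add_le_add (hw2.trans (nsmul_le_nsmul_left hw.le (by omega))) le_rfl
  have h8 : mk w ≤ 0 := by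
    rw [← add_zero (mk s), add_assoc, zero_add] at h7
    exact (add_le_add_iff_right_of_ne_top hs_ne_top).1 h7
  exact absurd hw (not_lt.2 h8)
end

section
open ArchimedeanClass Polynomial

lemma ArchimedeanClass.mk_le_mk_coe_iff {F K : Type*} [Field F] [Field K] [LinearOrder K] [IsStrictOrderedRing K]
    [Algebra F K] {L : IntermediateField F K} (a b : L) :
    mk (a : K) ≤ mk (b : K) ↔ mk a ≤ mk b := by
  simp only [mk_le_mk]
  rfl

lemma false_of_algebraic_infinitesimal_point {K : Type*} [Field K] [LinearOrder K]
    [IsStrictOrderedRing K] [Algebra ℝ K]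
    {n : ℕ} {s y u : K} {x : Fin n → K} (hs0 : s ≠ 0) (hs : 0 < mk s)
    (hx : ∀ i, 0 ≤ mk (x i)) (hu : 0 ≤ mk u) (hy : y = s + s ^ 2 * u)
    {Q : Fin (n + 1) → ℝ[X][X]} (hQ : ∀ i, Q i ≠ 0) {q κ : ℕ} (hq : ∀ i, (Q i).natDegree ≤ q)
    (hqκ : q < κ)
    (hroot : ∀ i, (Q i).eval₂ (aeval s : ℝ[X] →ₐ[ℝ] K).toRingHom
      ((Fin.snoc x y : Fin (n + 1) → K) i) = 0)
    {P : MvPolynomial (Fin (n + 1)) ℝ}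
    (hP : MvPolynomial.aeval (Fin.snoc x y : Fin (n + 1) → K) P = 0)
    (hPy : MvPolynomial.aeval (Fin.snoc x y : Fin (n + 1) → K)
      (MvPolynomial.pderiv (Fin.last n) P) ≠ 0)
    (hG : ∀ i : Fin n, mk (s ^ (κ - 1) * MvPolynomial.aeval (Fin.snoc x y : Fin (n + 1) → K)
        (MvPolynomial.pderiv (Fin.last n) P) ^ κ) ≤
      mk (MvPolynomial.aeval (Fin.snoc x y : Fin (n + 1) → K)
        (MvPolynomial.pderiv i.castSucc P) ^ κ)) : False := by
  let i1 : Algebra ℝ[X] K := (aeval s : ℝ[X] →ₐ[ℝ] K).toAlgebra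
  have hmap : ∀ p : ℝ[X], algebraMap ℝ[X] K p = aeval s p := fun p => rfl
  have hinj : Function.Injective (algebraMap ℝ[X] K) := by
    rw [injective_iff_map_eq_zero]
    intro a ha
    by_contra h
    exact aeval_ne_zero_of_infinitesimal hs0 hs h ha
  have i2 : FaithfulSMul ℝ[X] K := (faithfulSMul_iff_algebraMap_injective _ _).2 hinj
  let i3 : Algebra (FractionRing ℝ[X]) K := FractionRing.liftAlgebra ℝ[X] K
  have i4 : IsScalarTower ℝ[X] (FractionRing ℝ[X]) K := inferInstance
  have i5 : IsScalarTower ℝ ℝ[X] K := by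
    refine IsScalarTower.of_algebraMap_eq fun r => ?_
    rw [hmap, algebraMap_eq, aeval_C]
  have i6 : IsScalarTower ℝ (FractionRing ℝ[X]) K := by
    refine IsScalarTower.of_algebraMap_eq fun r => ?_
    rw [IsScalarTower.algebraMap_apply ℝ ℝ[X] (FractionRing ℝ[X]),
      ← IsScalarTower.algebraMap_apply ℝ[X] (FractionRing ℝ[X]) K,
      ← IsScalarTower.algebraMap_apply ℝ ℝ[X] K]
  let L : IntermediateField (FractionRing ℝ[X]) K :=
    IntermediateField.adjoin _ (Set.range (Fin.snoc x y : Fin (n + 1) → K))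
  have h_integral : ∀ z ∈ Set.range (Fin.snoc x y : Fin (n + 1) → K),
      IsIntegral (FractionRing ℝ[X]) z := by
    rintro _ ⟨i, rfl⟩
    refine IsAlgebraic.isIntegral ⟨(Q i).map (algebraMap _ _), ?_, ?_⟩
    · rw [Ne, Polynomial.map_eq_zero_iff (IsFractionRing.injective ℝ[X] (FractionRing ℝ[X]))]
      exact hQ i
    · rw [aeval_map_algebraMap, aeval_def]
      exact hroot i
  have i7 : FiniteDimensional (FractionRing ℝ[X]) L :=
    IntermediateField.finiteDimensional_adjoin h_integral
  have hmem : ∀ i, (Fin.snoc x y : Fin (n + 1) → K) i ∈ L := fun i =>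
    IntermediateField.subset_adjoin _ _ ⟨i, rfl⟩
  let x' : Fin n → L := fun i => ⟨x i, by simpa using hmem i.castSucc⟩
  let y' : L := ⟨y, by simpa using hmem (Fin.last n)⟩
  let s' : L := algebraMap ℝ[X] L X
  have hs' : (s' : K) = s := by
    change algebraMap ℝ[X] K X = s
    rw [hmap, aeval_X]
  let u' : L := (y' - s') / s' ^ 2
  let ι : L →ₐ[ℝ] K := L.val.restrictScalars ℝ
  have hι : ∀ a : L, ι a = (a : K) := fun a => rfl
  have hu' : ι u' = u := by
    have h1 : ι y' = y := rfl
    have h2 : ι s' = s := hs'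
    rw [map_div₀, map_sub, map_pow, h1, h2, hy]
    field_simp
    ring
  have hsnoc : ∀ i, ι ((Fin.snoc x' y' : Fin (n + 1) → L) i) = (Fin.snoc x y : Fin (n + 1) → K) i := by
    intro i
    refine Fin.lastCases ?_ (fun j => ?_) i
    · simp [hι, y']
    · simp [hι, x']
  have hv : ∀ R : MvPolynomial (Fin (n + 1)) ℝ,
      ((MvPolynomial.aeval (Fin.snoc x' y' : Fin (n + 1) → L) R : L) : K)
        = MvPolynomial.aeval (Fin.snoc x y : Fin (n + 1) → K) R := by
    intro R
    rw [← hι, ← funext hsnoc, MvPolynomial.comp_aeval_apply]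
  set Py' := MvPolynomial.aeval (Fin.snoc x' y' : Fin (n + 1) → L)
    (MvPolynomial.pderiv (Fin.last n) P) with hPy'
  have hPy0 : Py' ≠ 0 := by
    intro h
    exact hPy (by rw [← hv, ← hPy', h]; rfl)
  have hroot' : ∀ i : Fin n, (Q i.castSucc).eval₂ (aeval s' : ℝ[X] →ₐ[ℝ] L).toRingHom (x' i) = 0 := by
    intro i
    apply ι.toRingHom.injective
    rw [hom_eval₂, map_zero]
    have h := hroot i.castSucc
    rw [← hsnoc] at h
    rw [← h]
    congr 1
    · refine RingHom.ext fun p => ?_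
      change ι (aeval s' p) = aeval s p
      rw [← aeval_algHom_apply]
      rw [show ι s' = s from hs']
    · simp
  have hle : ∀ a b : L, mk (ι a) ≤ mk (ι b) → mk a ≤ mk b := fun a b h => mk_le_mk_coe_iff a b |>.1 h
  obtain ⟨G, hG1, hG2⟩ : ∃ G : L, (∀ i : Fin n, mk G + mk Py' ≤
      mk (MvPolynomial.aeval (Fin.snoc x' y' : Fin (n + 1) → L) (MvPolynomial.pderiv i.castSucc P)))
      ∧ (κ - 1) • mk s' ≤ κ • mk G := by
    rcases isEmpty_or_nonempty (Fin n) with h | h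
    · refine ⟨0, fun i => isEmptyElim i, ?_⟩
      rw [← mk_pow κ, zero_pow (by omega), mk_zero]
      exact le_top
    · obtain ⟨i0, hi0⟩ := Finite.exists_min fun i : Fin n =>
        mk (MvPolynomial.aeval (Fin.snoc x' y' : Fin (n + 1) → L) (MvPolynomial.pderiv i.castSucc P))
      set Pi := MvPolynomial.aeval (Fin.snoc x' y' : Fin (n + 1) → L)
        (MvPolynomial.pderiv i0.castSucc P) with hPi
      refine ⟨Pi / Py', fun i => ?_, ?_⟩
      · rw [← mk_mul, div_mul_cancel₀ _ hPy0]
        exact hi0 i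
      · have h1 : mk (s' ^ (κ - 1) * Py' ^ κ) ≤ mk (Pi ^ κ) := by
          apply hle
          rw [map_mul, map_pow, map_pow, map_pow]
          rw [hι, hι, hι, hs', hPy', hPi, hv, hv]
          exact hG i0
        rw [← mk_pow, ← mk_pow]
        have h2 : mk (Py' ^ κ) ≠ ⊤ := by
          rw [Ne, mk_eq_top_iff]; exact pow_ne_zero _ hPy0
        rw [← add_le_add_iff_left_of_ne_top h2, ← mk_mul, ← mk_mul, div_pow,
          div_mul_cancel₀ _ (pow_ne_zero _ hPy0)]
        exact h1
  have i8 : IsScalarTower ℝ ℝ[X] L := by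
    refine IsScalarTower.of_algebraMap_eq fun r => ?_
    apply ι.toRingHom.injective
    exact IsScalarTower.algebraMap_apply ℝ ℝ[X] K r
  refine false_of_algebraic_infinitesimal_point_aux (L := L) (s := s') (y := y') (G := G) (u := u')
    (x := x') (P := P) (Q := fun i => Q i.castSucc) ?_ rfl ?_ ?_ ?_ (fun i => hQ _) (fun i => hq _)
    hqκ hroot' ?_ hPy0 hG1 hG2
  · refine lt_of_not_ge fun h => not_le_of_gt hs ?_
    have := mk_le_mk_coe_iff s' 1 |>.2 (by rwa [mk_one])
    simpa [hs'] using this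
  · intro i
    refine mk_one (R := L) ▸ hle _ _ ?_
    rw [map_one, mk_one]
    exact hx i
  · refine mk_one (R := L) ▸ hle _ _ ?_
    rw [hu', map_one, mk_one]
    exact hu
  · apply ι.toRingHom.injective
    change ι y' = ι (s' + s' ^ 2 * u')
    rw [map_add, map_mul, map_pow, hu', show ι s' = s from hs', show ι y' = y from rfl, hy]
  · apply ι.toRingHom.injective
    change ι _ = ι 0
    rw [hι, hv, hP, map_zero]
end

section
open ArchimedeanClass Polynomial Filter Topology Hyperreal

lemma false_of_algebraic_seq {n q κ : ℕ} (hqκ : q < κ) {P : MvPolynomial (Fin (n + 1)) ℝ}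
    {Q : Fin (n + 1) → ℝ[X][X]} (hQ : ∀ i, Q i ≠ 0) (hq : ∀ i, (Q i).natDegree ≤ q)
    {s y : ℕ → ℝ} {x : ℕ → Fin n → ℝ} (hs : ∀ j, 0 < s j) (hs0 : Tendsto s atTop (𝓝 0)) {C : ℝ}
    (hx : ∀ j i, |x j i| ≤ C) (hy : ∀ j, |y j - s j| ≤ C * s j ^ 2)
    (hroot : ∀ j i, (Q i).eval₂ (evalRingHom (s j))
      ((Fin.snoc (x j) (y j) : Fin (n + 1) → ℝ) i) = 0)
    (hP : ∀ j, MvPolynomial.eval (Fin.snoc (x j) (y j) : Fin (n + 1) → ℝ) P = 0)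
    (hPy : ∀ j, MvPolynomial.eval (Fin.snoc (x j) (y j) : Fin (n + 1) → ℝ)
      (MvPolynomial.pderiv (Fin.last n) P) ≠ 0)
    (hG : ∀ j, ∀ i : Fin n, |MvPolynomial.eval (Fin.snoc (x j) (y j) : Fin (n + 1) → ℝ)
        (MvPolynomial.pderiv i.castSucc P)| ^ κ ≤ C * (s j ^ (κ - 1) *
      |MvPolynomial.eval (Fin.snoc (x j) (y j) : Fin (n + 1) → ℝ)
        (MvPolynomial.pderiv (Fin.last n) P)| ^ κ)) : False := by
  let i1 : Algebra ℝ ℝ* := Hyperreal.coeRingHom.toAlgebra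
  let φ : (ℕ → ℝ) →ₐ[ℝ] ℝ* :=
    { Filter.Germ.coeRingHom (hyperfilter ℕ : Filter ℕ) with commutes' := fun r => rfl }
  have hval : ∀ R : MvPolynomial (Fin (n + 1)) ℝ, MvPolynomial.aeval
      (Fin.snoc (fun i => φ fun j => x j i) (φ y) : Fin (n + 1) → ℝ*) R
      = φ fun j => MvPolynomial.eval (Fin.snoc (x j) (y j) : Fin (n + 1) → ℝ) R := by
    intro R
    have h1 : (Fin.snoc (fun i => φ fun j => x j i) (φ y) : Fin (n + 1) → ℝ*)
        = fun i => φ ((Fin.snoc (fun i j => x j i) y : Fin (n + 1) → ℕ → ℝ) i) := by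
      ext i
      refine Fin.lastCases ?_ (fun l => ?_) i <;> simp
    rw [h1, ← MvPolynomial.comp_aeval_apply]
    congr 1
    ext j
    have h2 := MvPolynomial.comp_aeval_apply (Fin.snoc (fun i j => x j i) y : Fin (n + 1) → ℕ → ℝ)
      (Pi.evalAlgHom ℝ (fun _ => ℝ) j) R
    rw [Pi.evalAlgHom_apply] at h2
    rw [h2, MvPolynomial.aeval_eq_eval]
    congr 2
    ext i
    refine Fin.lastCases ?_ (fun l => ?_) i <;> simp
  have hbdd : ∀ a b : ℕ → ℝ, (∀ j, |a j| ≤ C * |b j|) → mk (φ b) ≤ mk (φ a) := by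
    intro a b h
    refine mk_le_mk.2 ⟨⌈C⌉₊, ?_⟩
    have h1 : ∀ j, |a j| ≤ ⌈C⌉₊ • |b j| := fun j => (h j).trans (by
      rw [nsmul_eq_mul]
      exact mul_le_mul_of_nonneg_right (Nat.le_ceil C) (abs_nonneg _))
    have h2 : ∀ c : ℕ → ℝ, |φ c| = φ fun j => |c j| := fun c => rfl
    rw [h2, h2, ← map_nsmul]
    exact ofSeq_le_ofSeq.2 (Eventually.of_forall h1)
  have hne : ∀ a : ℕ → ℝ, (∀ j, a j ≠ 0) → φ a ≠ 0 := by
    intro a h h0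
    obtain ⟨j, hj⟩ := (Germ.coe_eq (l := (hyperfilter ℕ : Filter ℕ)) (f := a) (g := fun _ => (0 : ℝ)) |>.1 h0).exists
    exact h j hj
  have hu : 0 ≤ mk (φ fun j => (y j - s j) / s j ^ 2) := by
    rw [← mk_one (R := ℝ*), ← map_one φ]
    refine hbdd _ _ fun j => ?_
    rw [abs_div, abs_of_pos (pow_pos (hs j) 2), div_le_iff₀ (pow_pos (hs j) 2)]
    simpa using hy j
  refine false_of_algebraic_infinitesimal_point (K := ℝ*) (s := φ s) (y := φ y)
    (x := fun i => φ fun j => x j i) (u := φ fun j => (y j - s j) / s j ^ 2) (P := P) (Q := Q)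
    ?_ ?_ ?_ hu ?_ hQ hq hqκ ?_ ?_ ?_ ?_
  · exact hne _ fun j => (hs j).ne'
  · exact archimedeanClassMk_pos_of_tendsto (x := φ s) ((hs0.mono_left Nat.hyperfilter_le_atTop))
  · intro i
    rw [← mk_one (R := ℝ*), ← map_one φ]
    refine hbdd _ _ fun j => ?_
    simpa using hx j i
  · rw [← map_pow, ← map_mul, ← map_add]
    congr 1
    ext j
    have := (hs j).ne'
    simp only [Pi.add_apply, Pi.mul_apply, Pi.pow_apply]
    field_simp
    ring
  · intro i
    have h1 : (Fin.snoc (fun i => φ fun j => x j i) (φ y) : Fin (n + 1) → ℝ*) i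
        = φ fun j => (Fin.snoc (x j) (y j) : Fin (n + 1) → ℝ) i := by
      refine Fin.lastCases ?_ (fun l => ?_) i <;> simp
    have h2 : (aeval (φ s) : ℝ[X] →ₐ[ℝ] ℝ*).toRingHom
        = φ.toRingHom.comp (aeval s : ℝ[X] →ₐ[ℝ] (ℕ → ℝ)).toRingHom := by
      refine RingHom.ext fun p => ?_
      exact aeval_algHom_apply φ s p
    rw [h1, h2]
    change eval₂ _ (φ.toRingHom _) _ = _
    rw [← hom_eval₂]
    refine (congrArg φ ?_).trans (map_zero φ)
    ext j
    have h3 := hom_eval₂ (Q i) (aeval s : ℝ[X] →ₐ[ℝ] (ℕ → ℝ)).toRingHom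
      (Pi.evalRingHom (fun _ : ℕ => ℝ) j) (fun j => (Fin.snoc (x j) (y j) : Fin (n + 1) → ℝ) i)
    rw [Pi.evalRingHom_apply] at h3
    rw [h3, Pi.zero_apply, ← hroot j i]
    congr 1
    refine RingHom.ext fun p => ?_
    exact (aeval_algHom_apply (Pi.evalAlgHom ℝ (fun _ : ℕ => ℝ) j) s p).symm
  · rw [hval]
    simp_rw [hP]
    exact map_zero φ
  · rw [hval]
    exact hne _ hPy
  · intro i
    rw [hval, hval, ← map_pow, ← map_pow, ← map_mul, ← map_pow]
    refine hbdd _ _ fun j => ?_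
    simp only [Pi.mul_apply, Pi.pow_apply, abs_mul, abs_pow, abs_of_pos (hs j)]
    exact hG j i
end

section
open MvPolynomial

/-- The monomials with all exponents less than `D` span modulo the relations `X i ^ D = G i` with
`G i` of total degree less than `D`. -/
lemma span_monomial_lt_sup_ideal_eq_top {ι B : Type*} [Fintype ι] [CommRing B] {D : ℕ}
    {G : ι → MvPolynomial ι B} (hG : ∀ i, (G i).totalDegree < D) :
    Submodule.span B (Set.range fun α : ι → Fin D =>
        monomial (Finsupp.equivFunOnFinite.symm fun i => (α i : ℕ)) (1 : B)) ⊔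
      (Ideal.span (Set.range fun i => (X i ^ D - G i : MvPolynomial ι B))).restrictScalars B = ⊤ := by
  classical
  set I := Ideal.span (Set.range fun i => (X i ^ D - G i : MvPolynomial ι B))
  set W := Submodule.span B (Set.range fun α : ι → Fin D =>
        monomial (Finsupp.equivFunOnFinite.symm fun i => (α i : ℕ)) (1 : B)) ⊔ I.restrictScalars B
  have hpoly : ∀ p : MvPolynomial ι B,
      (∀ m : ι →₀ ℕ, m.degree ≤ p.totalDegree → monomial m (1 : B) ∈ W) → p ∈ W := by
    intro p hp
    rw [p.as_sum]
    refine Submodule.sum_mem _ fun m hm => ?_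
    rw [← mul_one (coeff m p), ← smul_eq_mul, ← smul_monomial]
    exact W.smul_mem _ (hp m (le_totalDegree hm))
  have hmono : ∀ e, ∀ m : ι →₀ ℕ, m.degree = e → monomial m (1 : B) ∈ W := by
    intro e
    induction e using Nat.strong_induction_on with
    | _ e ih =>
    intro m hm
    by_cases hlt : ∀ i, m i < D
    · refine Submodule.mem_sup_left (Submodule.subset_span ⟨fun i => ⟨m i, hlt i⟩, ?_⟩)
      ext i
      simp
    · push Not at hlt
      obtain ⟨i, hi⟩ := hlt
      obtain ⟨m', rfl⟩ : ∃ m', m = m' + Finsupp.single i D :=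
        ⟨m - Finsupp.single i D, (tsub_add_cancel_of_le (by simpa using hi)).symm⟩
      have h1 : (monomial (m' + Finsupp.single i D) (1 : B))
          = monomial m' 1 * (X i ^ D - G i) + monomial m' 1 * G i := by
        rw [X_pow_eq_monomial, mul_sub, monomial_mul]
        simp
      rw [h1]
      refine W.add_mem (Submodule.mem_sup_right ?_) (hpoly _ fun l hl => ih l.degree ?_ l rfl)
      · exact I.mul_mem_left _ (Ideal.subset_span ⟨i, rfl⟩)
      · rw [← hm, map_add, Finsupp.degree_single]
        refine hl.trans_lt ((totalDegree_mul _ _).trans_lt ?_)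
        refine add_lt_add_of_le_of_lt ?_ (hG i)
        rcases subsingleton_or_nontrivial B with h | h
        · rw [Subsingleton.elim (monomial m' (1 : B)) 0]; simp
        · rw [totalDegree_monomial _ one_ne_zero]; exact le_rfl
  rw [eq_top_iff]
  exact fun p _ => hpoly p fun m _ => hmono _ m rfl

/-- Eigenvalue method: if `X i ^ D = G i` with `G i` of total degree less than `D`, each coordinate
of a solution is a root of a monic polynomial of degree `D ^ card ι` over the coefficient ring. -/
lemma exists_monic_eval₂_eq_zero_of_pow_eq {ι B : Type*} [Fintype ι] [CommRing B] [Nontrivial B]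
    {D : ℕ} (hD : 0 < D)
    {G : ι → MvPolynomial ι B} (hG : ∀ i, (G i).totalDegree < D) (i₀ : ι) :
    ∃ χ : Polynomial B, χ.Monic ∧ χ.natDegree = D ^ Fintype.card ι ∧
      ∀ (ψ : B →+* ℝ) (x : ι → ℝ), (∀ i, x i ^ D = eval₂ ψ x (G i)) → χ.eval₂ ψ (x i₀) = 0 := by
  classical
  have hred : ∀ p : MvPolynomial ι B, ∃ c : (ι → Fin D) → B,
      ∀ (ψ : B →+* ℝ) (x : ι → ℝ), (∀ i, x i ^ D = eval₂ ψ x (G i)) →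
        eval₂ ψ x p = ∑ α, ψ (c α) * ∏ i, x i ^ (α i : ℕ) := by
    intro p
    have hp : p ∈ (⊤ : Submodule B (MvPolynomial ι B)) := trivial
    rw [← span_monomial_lt_sup_ideal_eq_top hG, Submodule.mem_sup] at hp
    obtain ⟨a, ha, b, hb, rfl⟩ := hp
    obtain ⟨c, rfl⟩ := (Submodule.mem_span_range_iff_exists_fun B).1 ha
    refine ⟨c, fun ψ x hx => ?_⟩
    have hb0 : eval₂Hom ψ x b = 0 := by
      have : Ideal.span (Set.range fun i => (X i ^ D - G i : MvPolynomial ι B))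
          ≤ RingHom.ker (eval₂Hom ψ x) := by
        rw [Ideal.span_le]
        rintro _ ⟨i, rfl⟩
        simp [RingHom.mem_ker, hx i]
      exact this hb
    rw [eval₂_add, show eval₂ ψ x b = 0 from hb0, add_zero, ← coe_eval₂Hom, map_sum]
    refine Finset.sum_congr rfl fun α _ => ?_
    rw [smul_monomial, coe_eval₂Hom, eval₂_monomial, Finsupp.prod_fintype _ _ (by simp)]
    simp
  choose c hc using fun α : ι → Fin D => hred
    (X i₀ * monomial (Finsupp.equivFunOnFinite.symm fun i => (α i : ℕ)) (1 : B))
  let M : Matrix (ι → Fin D) (ι → Fin D) B := Matrix.of c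
  refine ⟨M.charpoly, M.charpoly_monic, ?_, fun ψ x hx => ?_⟩
  · rw [M.charpoly_natDegree_eq_dim]; simp
  rw [← Polynomial.eval_map, ← Matrix.charpoly_map, Matrix.eval_charpoly,
    ← Matrix.exists_mulVec_eq_zero_iff]
  refine ⟨fun α => ∏ i, x i ^ (α i : ℕ), ?_, ?_⟩
  · intro h
    have := congrFun h fun _ => ⟨0, hD⟩
    simp at this
  · rw [Matrix.sub_mulVec, sub_eq_zero]
    ext α
    have h := hc α ψ x hx
    rw [eval₂_mul, eval₂_X, eval₂_monomial, Finsupp.prod_fintype _ _ (by simp)] at h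
    simp only [Matrix.mulVec, dotProduct, Matrix.map_apply, M, Matrix.of_apply]
    rw [← h]
    simp [Matrix.scalar_apply, Matrix.diagonal_apply]
end

section
open MvPolynomial

lemma hasStrictFDerivAt_mvPolynomial_eval {ι : Type*} [Fintype ι] (p : MvPolynomial ι ℝ)
    (x : ι → ℝ) :
    HasStrictFDerivAt (fun x : ι → ℝ => eval x p)
      (∑ i, eval x (pderiv i p) • (ContinuousLinearMap.proj i : (ι → ℝ) →L[ℝ] ℝ)) x := by
  classical
  induction p using MvPolynomial.induction_on with
  | C a =>
    simp only [eval_C, pderiv_C, map_zero, zero_smul, Finset.sum_const_zero]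
    exact hasStrictFDerivAt_const _ _
  | add p q hp hq =>
    simp only [map_add, add_smul, Finset.sum_add_distrib]
    exact hp.add hq
  | mul_X p j hp =>
    have h2 : HasStrictFDerivAt (fun x : ι → ℝ => x j)
      (ContinuousLinearMap.proj j : (ι → ℝ) →L[ℝ] ℝ) x :=
      (ContinuousLinearMap.proj j : (ι → ℝ) →L[ℝ] ℝ).hasStrictFDerivAt
    simp only [map_mul, eval_X]
    refine (hp.mul h2).congr_fderiv ?_
    ext v
    simp [pderiv_X, Pi.single_apply, Finset.sum_add_distrib, add_mul, Finset.mul_sum, apply_ite]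
    exact Finset.sum_congr rfl fun i _ => by ring

end

section
open MvPolynomial Filter Topology

/-- Each coordinate of a nondegenerate real zero of a polynomial system with coefficients in `ℝ[s]`
is a root of a fixed nonzero polynomial over `ℝ[s]` of controlled degree. -/
lemma exists_eval₂_eq_zero_of_nondegenerate {ι : Type*} [Fintype ι] {D : ℕ}
    {F : ι → MvPolynomial ι (Polynomial ℝ)} (hF : ∀ i, (F i).totalDegree < D) (i₀ : ι) :
    ∃ Q : Polynomial (Polynomial ℝ), Q ≠ 0 ∧ Q.natDegree ≤ D ^ Fintype.card ι ∧
      ∀ (s : ℝ) (x : ι → ℝ), (∀ i, eval₂ (Polynomial.evalRingHom s) x (F i) = 0) →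
        (∀ v : ι → ℝ, (∀ i, ∑ j, eval₂ (Polynomial.evalRingHom s) x (pderiv j (F i)) * v j = 0) →
          v = 0) →
        Q.eval₂ (Polynomial.evalRingHom s) (x i₀) = 0 := by
  classical
  have hD : 0 < D := (Nat.zero_le _).trans_lt (hF i₀)
  let G : ι → MvPolynomial ι (Polynomial (Polynomial ℝ)) := fun i =>
    -(C Polynomial.X * map Polynomial.C (F i))
  have hG : ∀ i, (G i).totalDegree < D := by
    intro i
    refine lt_of_le_of_lt ?_ (hF i)
    rw [totalDegree_neg]
    refine (totalDegree_mul _ _).trans ?_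
    rw [totalDegree_C, zero_add]
    exact Finset.sup_mono (support_map_subset _ _)
  obtain ⟨χ, hmon, hdeg, hχ⟩ := exists_monic_eval₂_eq_zero_of_pow_eq hD hG i₀
  let m := χ.support.sup fun k => (χ.coeff k).natDegree
  have hm : ∀ k, (χ.coeff k).natDegree ≤ m := by
    intro k
    by_cases hk : k ∈ χ.support
    · exact Finset.le_sup (f := fun k => (χ.coeff k).natDegree) hk
    · rw [Polynomial.notMem_support_iff.1 hk]; simp
  let Q : Polynomial (Polynomial ℝ) := ∑ k ∈ χ.support, Polynomial.monomial k ((χ.coeff k).coeff m)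
  have hQc : ∀ k, Q.coeff k = (χ.coeff k).coeff m := by
    intro k
    simp only [Q, Polynomial.finsetSum_coeff, Polynomial.coeff_monomial]
    rw [Finset.sum_ite_eq']
    split_ifs with h
    · rfl
    · rw [Polynomial.notMem_support_iff.1 h]; simp
  have hsupp : χ.support.Nonempty := by
    rw [Polynomial.support_nonempty]; exact hmon.ne_zero
  refine ⟨Q, ?_, ?_, fun s x hx hnd => ?_⟩
  · obtain ⟨k, hk, hkm⟩ := Finset.exists_mem_eq_sup χ.support hsupp
      fun k => (χ.coeff k).natDegree
    intro h
    have h1 := hQc k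
    rw [h, Polynomial.coeff_zero, show m = _ from hkm] at h1
    exact Polynomial.mem_support_iff.1 hk (Polynomial.leadingCoeff_eq_zero.1 h1.symm)
  · rw [← hdeg, Polynomial.natDegree_le_iff_coeff_eq_zero]
    intro k hk
    rw [hQc, Polynomial.coeff_eq_zero_of_natDegree_lt hk, Polynomial.coeff_zero]
  let e := Polynomial.evalRingHom s
  let h : ℝ × (ι → ℝ) → ℝ := fun p => ∑ k ∈ χ.support,
    (Polynomial.eval p.1 ((χ.coeff k).map e |>.reflect m)) * p.2 i₀ ^ k
  have hcont : Continuous h := by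
    refine continuous_finsetSum _ fun k _ => Continuous.mul ?_ ?_
    · exact (Polynomial.continuous _).comp continuous_fst
    · exact ((continuous_apply i₀).comp continuous_snd).pow k
  have h0 : h (0, x) = Q.eval₂ e (x i₀) := by
    simp only [h, Q, Polynomial.eval₂_finsetSum, Polynomial.eval₂_monomial]
    refine Finset.sum_congr rfl fun k _ => ?_
    rw [← Polynomial.coeff_zero_eq_eval_zero, Polynomial.coeff_reflect, Polynomial.revAt_le (Nat.zero_le _), Nat.sub_zero, Polynomial.coeff_map]
  have hz : ∀ ζ : ℝ, ζ ≠ 0 → ∀ z : ι → ℝ,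
      (∀ i, eval₂ e z (F i) + ζ * z i ^ D = 0) → h (ζ, z) = 0 := by
    intro ζ hζ z hFz
    let ψ : Polynomial (Polynomial ℝ) →+* ℝ := Polynomial.eval₂RingHom e ζ⁻¹
    have h1 : χ.eval₂ ψ (z i₀) = 0 := by
      refine hχ ψ z fun i => ?_
      have hψ : ψ.comp Polynomial.C = e := by ext <;> simp [ψ]
      simp only [G]
      rw [eval₂_neg, eval₂_mul, eval₂_C, eval₂_map, hψ]
      have : ψ Polynomial.X = ζ⁻¹ := by simp [ψ]
      rw [this]
      have := hFz i
      field_simp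
      linarith
    have h2 : h (ζ, z) = ζ ^ m * χ.eval₂ ψ (z i₀) := by
      rw [Polynomial.eval₂_eq_sum, Polynomial.sum, Finset.mul_sum]
      refine Finset.sum_congr rfl fun k _ => ?_
      rw [← mul_assoc]
      congr 1
      let inv : Invertible ζ⁻¹ := invertibleOfNonzero (inv_ne_zero hζ)
      have h3 := Polynomial.eval₂_reflect_mul_pow (RingHom.id ℝ) ζ⁻¹ m ((χ.coeff k).map e)
        (Polynomial.natDegree_map_le.trans (hm k))
      rw [invOf_eq_inv, inv_inv] at h3
      simp only [Polynomial.eval₂_id] at h3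
      change _ = ζ ^ m * Polynomial.eval₂ e ζ⁻¹ _
      rw [← Polynomial.eval_map, ← h3, mul_left_comm, ← mul_pow, mul_inv_cancel₀ hζ, one_pow, mul_one]
    rw [h2, h1, mul_zero]
  rw [← h0]
  by_contra hne
  let F' : ι → MvPolynomial ι ℝ := fun i => map e (F i)
  have hF' : ∀ i z, eval z (F' i) = eval₂ e z (F i) := fun i z => eval_map _ _ _
  let H : ℝ × (ι → ℝ) → ℝ × (ι → ℝ) := fun p => (p.1, fun i => eval p.2 (F' i) + p.1 * p.2 i ^ D)
  let L : ℝ × (ι → ℝ) →L[ℝ] ℝ × (ι → ℝ) := (ContinuousLinearMap.fst ℝ ℝ (ι → ℝ)).prod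
    (ContinuousLinearMap.pi fun i => (∑ j, eval x (pderiv j (F' i)) •
      (ContinuousLinearMap.proj j : (ι → ℝ) →L[ℝ] ℝ)).comp (ContinuousLinearMap.snd ℝ ℝ (ι → ℝ))
      + x i ^ D • ContinuousLinearMap.fst ℝ ℝ (ι → ℝ))
  have hHL : HasStrictFDerivAt H L (0, x) := by
    refine hasStrictFDerivAt_fst.prodMk (hasStrictFDerivAt_pi.2 fun i => ?_)
    have h1 : HasStrictFDerivAt (fun p : ℝ × (ι → ℝ) => eval p.2 (F' i)) _ (0, x) :=
      HasStrictFDerivAt.comp (g := fun z => eval z (F' i)) (f := Prod.snd) ((0 : ℝ), x)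
        (hasStrictFDerivAt_mvPolynomial_eval (F' i) x) hasStrictFDerivAt_snd
    have h2 : HasStrictFDerivAt (fun p : ℝ × (ι → ℝ) => p.2 i) _ (0, x) :=
      ((ContinuousLinearMap.proj i : (ι → ℝ) →L[ℝ] ℝ).comp
        (ContinuousLinearMap.snd ℝ ℝ (ι → ℝ))).hasStrictFDerivAt
    refine (h1.add ((hasStrictFDerivAt_fst (p := ((0 : ℝ), x))).mul (h2.pow D))).congr_fderiv ?_
    ext v <;> simp
  have hinj : Function.Injective L := by
    rw [injective_iff_map_eq_zero]
    rintro ⟨ζ, v⟩ hv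
    have h1 : ζ = 0 := congrArg Prod.fst hv
    subst h1
    have h2 : v = 0 := by
      refine hnd v fun i => ?_
      have := congrFun (congrArg Prod.snd hv) i
      simpa [L, F', pderiv_map, eval_map] using this
    rw [h2]; rfl
  have hsurj : L.range = ⊤ := by
    rw [LinearMap.range_eq_top]
    exact LinearMap.injective_iff_surjective.1 hinj
  have hmap := hHL.map_nhds_eq_of_surj hsurj
  have hH0 : H (0, x) = (0, 0) := by
    ext i
    · rfl
    · simp [H, hF', e, hx]
  have hA : {p | h p ≠ 0} ∈ 𝓝 ((0 : ℝ), x) := (hcont.continuousAt).eventually_ne hne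
  have hA' := image_mem_map (m := H) hA
  rw [hmap, hH0] at hA'
  have ht : Tendsto (fun ζ : ℝ => (ζ, (0 : ι → ℝ))) (𝓝[≠] 0) (𝓝 (0, 0)) :=
    (Continuous.prodMk_left (0 : ι → ℝ)).tendsto' 0 _ rfl |>.mono_left nhdsWithin_le_nhds
  obtain ⟨ζ, ⟨⟨ζ', z⟩, hz1, hz2⟩, hζ⟩ := ((ht.eventually hA').and self_mem_nhdsWithin).exists
  have h1 : ζ' = ζ := congrArg Prod.fst hz2
  subst h1
  refine hz1 (hz ζ' hζ z fun i => ?_)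
  rw [← hF']
  exact congrFun (congrArg Prod.snd hz2) i
end

section
open MvPolynomial Filter Topology

/-- The point `(x, f x)` of the graph of `f`. -/
def graphPoint {n : ℕ} (f : EuclideanSpace ℝ (Fin n) → ℝ) (x : EuclideanSpace ℝ (Fin n)) :
    Fin (n + 1) → ℝ :=
  Fin.snoc (fun i => x i) (f x)

lemma hasFDerivAt_eval_graphPoint {n : ℕ} {f : EuclideanSpace ℝ (Fin n) → ℝ}
    {x : EuclideanSpace ℝ (Fin n)} (hf : DifferentiableAt ℝ f x)
    (R : MvPolynomial (Fin (n + 1)) ℝ) :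
    HasFDerivAt (fun x => eval (graphPoint f x) R)
      (∑ i : Fin n, eval (graphPoint f x) (pderiv i.castSucc R) • EuclideanSpace.proj (𝕜 := ℝ) i
        + eval (graphPoint f x) (pderiv (Fin.last n) R) • fderiv ℝ f x) x := by
  have h1 : HasFDerivAt (graphPoint f) (ContinuousLinearMap.pi
      (Fin.snoc (fun i : Fin n => EuclideanSpace.proj (𝕜 := ℝ) i) (fderiv ℝ f x) :
        Fin (n + 1) → EuclideanSpace ℝ (Fin n) →L[ℝ] ℝ)) x := by
    refine hasFDerivAt_pi.2 fun i => ?_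
    refine Fin.lastCases ?_ (fun l => ?_) i
    · simpa [graphPoint] using hf.hasFDerivAt
    · simpa [graphPoint] using (EuclideanSpace.proj (𝕜 := ℝ) l).hasFDerivAt (x := x)
  have h2 := HasFDerivAt.comp (g := fun z => eval z R) x
    (hasStrictFDerivAt_mvPolynomial_eval R (graphPoint f x)).hasFDerivAt h1
  refine h2.congr_fderiv ?_
  ext v
  simp [Fin.sum_univ_castSucc]

lemma contDiffAt_eval_graphPoint {n : ℕ} {f : EuclideanSpace ℝ (Fin n) → ℝ}
    {x : EuclideanSpace ℝ (Fin n)} {N : WithTop ℕ∞} (hf : ContDiffAt ℝ N f x)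
    (R : MvPolynomial (Fin (n + 1)) ℝ) :
    ContDiffAt ℝ N (fun x => eval (graphPoint f x) R) x := by
  induction R using MvPolynomial.induction_on with
  | C a => simpa using contDiffAt_const
  | add p q hp hq => simpa using hp.add hq
  | mul_X p j hp =>
    simp only [map_mul, eval_X]
    refine hp.mul ?_
    refine Fin.lastCases ?_ (fun l => ?_) j
    · simpa [graphPoint] using hf
    · simpa [graphPoint] using (EuclideanSpace.proj (𝕜 := ℝ) l).contDiff.contDiffAt (x := x)

/-- Numerator of the `i`-th component of the gradient of `A / E + c * X i`, restricted to the
hypersurface `P = 0` viewed as a graph over the first `n` coordinates. -/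
noncomputable def critNumerator {R : Type*} [CommRing R] {n : ℕ}
    (P A E : MvPolynomial (Fin (n + 1)) R) (c : R) (i : Fin n) : MvPolynomial (Fin (n + 1)) R :=
  (pderiv i.castSucc A * pderiv (Fin.last n) P - pderiv (Fin.last n) A * pderiv i.castSucc P) * E
    - A * (pderiv i.castSucc E * pderiv (Fin.last n) P
      - pderiv (Fin.last n) E * pderiv i.castSucc P)
    + C c * (pderiv (Fin.last n) P * E ^ 2)

lemma map_critNumerator {R S : Type*} [CommRing R] [CommRing S] (φ : R →+* S) {n : ℕ}
    (P A E : MvPolynomial (Fin (n + 1)) R) (c : R) (i : Fin n) :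
    map φ (critNumerator P A E c i) = critNumerator (map φ P) (map φ A) (map φ E) (φ c) i := by
  simp [critNumerator, pderiv_map]

lemma totalDegree_pderiv_le {R σ : Type*} [CommRing R] (i : σ) (p : MvPolynomial σ R) :
    (pderiv i p).totalDegree ≤ p.totalDegree - 1 := by
  classical
  conv_lhs => rw [p.as_sum, map_sum]
  refine totalDegree_finsetSum_le fun m hm => ?_
  rw [pderiv_monomial]
  by_cases h : coeff m p * (m i : R) = 0
  · rw [h]; simp
  · have hi : m i ≠ 0 := by
      intro h0
      simp [h0] at h
    have h1 : Finsupp.single i 1 ≤ m := by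
      rw [Finsupp.single_le_iff]; omega
    have h2 : (m - Finsupp.single i 1).degree + 1 = m.degree := by
      conv_rhs => rw [← tsub_add_cancel_of_le h1, map_add, Finsupp.degree_single]
    have h3 : m.degree ≤ p.totalDegree := le_totalDegree hm
    rw [totalDegree_monomial _ h]
    change (m - Finsupp.single i 1).degree ≤ _
    omega

lemma totalDegree_critNumerator_lt {R : Type*} [CommRing R] {n d : ℕ} (hd : 0 < d)
    {P A E : MvPolynomial (Fin (n + 1)) R} (hP : P.totalDegree ≤ d) (hA : A.totalDegree ≤ 2 * d)
    (hE : E.totalDegree ≤ 2 * d) (c : R) (i : Fin n) :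
    (critNumerator P A E c i).totalDegree < 5 * d := by
  have h1 : ∀ {p q : MvPolynomial (Fin (n + 1)) R} {a b : ℕ}, p.totalDegree ≤ a →
      q.totalDegree ≤ b → (p * q).totalDegree ≤ a + b := fun hp hq =>
    (totalDegree_mul _ _).trans (add_le_add hp hq)
  have h2 : ∀ {p q : MvPolynomial (Fin (n + 1)) R} {a : ℕ}, p.totalDegree ≤ a →
      q.totalDegree ≤ a → (p - q).totalDegree ≤ a := fun hp hq =>
    (totalDegree_sub _ _).trans (max_le hp hq)
  have h3 : ∀ j, (pderiv j P).totalDegree ≤ d - 1 := fun j =>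
    (totalDegree_pderiv_le j P).trans (by omega)
  have h4 : ∀ j, (pderiv j A).totalDegree ≤ 2 * d - 1 := fun j =>
    (totalDegree_pderiv_le j A).trans (by omega)
  have h5 : ∀ j, (pderiv j E).totalDegree ≤ 2 * d - 1 := fun j =>
    (totalDegree_pderiv_le j E).trans (by omega)
  have h6 : ((pderiv i.castSucc A * pderiv (Fin.last n) P
      - pderiv (Fin.last n) A * pderiv i.castSucc P) * E).totalDegree ≤ 5 * d - 1 :=
    (h1 (h2 (h1 (h4 _) (h3 _)) (h1 (h4 _) (h3 _))) hE).trans (by omega)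
  have h7 : (A * (pderiv i.castSucc E * pderiv (Fin.last n) P
      - pderiv (Fin.last n) E * pderiv i.castSucc P)).totalDegree ≤ 5 * d - 1 :=
    (h1 hA (h2 (h1 (h5 _) (h3 _)) (h1 (h5 _) (h3 _)))).trans (by omega)
  have h8 : (C c * (pderiv (Fin.last n) P * E ^ 2)).totalDegree ≤ 5 * d - 1 := by
    refine (h1 (totalDegree_C c).le (h1 (h3 _) ((totalDegree_pow _ _).trans
      (Nat.mul_le_mul_left 2 hE)))).trans (by omega)
  have h9 : (critNumerator P A E c i).totalDegree ≤ 5 * d - 1 :=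
    (totalDegree_add _ _).trans (max_le (h2 h6 h7) h8)
  omega

lemma eval_critNumerator_graphPoint {n : ℕ} {f Ψ : EuclideanSpace ℝ (Fin n) → ℝ}
    {x : EuclideanSpace ℝ (Fin n)} (hf : DifferentiableAt ℝ f x)
    {P A E : MvPolynomial (Fin (n + 1)) ℝ} (hP : ∀ᶠ z in 𝓝 x, eval (graphPoint f z) P = 0)
    (hE : eval (graphPoint f x) E ≠ 0)
    (hΨ : Ψ =ᶠ[𝓝 x] fun z => eval (graphPoint f z) A / eval (graphPoint f z) E) (c : ℝ) (i : Fin n) :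
    eval (graphPoint f x) (critNumerator P A E c i)
      = eval (graphPoint f x) (pderiv (Fin.last n) P) * eval (graphPoint f x) E ^ 2
        * (gradient Ψ x i + c) := by
  have hA' := hasFDerivAt_eval_graphPoint hf A
  have hE' := hasFDerivAt_eval_graphPoint hf E
  have hP' := hasFDerivAt_eval_graphPoint hf P
  have hΨd : DifferentiableAt ℝ Ψ x := by
    simp only [div_eq_mul_inv] at hΨ
    exact (hA'.differentiableAt.fun_mul
      (DifferentiableAt.fun_inv hE'.differentiableAt hE)).congr_of_eventuallyEq hΨ
  have hPz := hP'.unique ((hasFDerivAt_const (0 : ℝ) x).congr_of_eventuallyEq hP)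
  have hAe : (fun z => eval (graphPoint f z) A) =ᶠ[𝓝 x] fun z => Ψ z * eval (graphPoint f z) E := by
    filter_upwards [hΨ, hE'.continuousAt.eventually_ne hE] with z hz hz'
    rw [hz, div_mul_cancel₀ _ hz']
  have hAz := hA'.unique ((hΨd.hasFDerivAt.mul hE').congr_of_eventuallyEq hAe)
  have hAv := hAe.eq_of_nhds
  have hg : gradient Ψ x i = fderiv ℝ Ψ x (EuclideanSpace.single i 1) := by
    rw [← inner_gradient_left, EuclideanSpace.inner_single_right]
    simp
  have e1 := congrArg (fun l => l (EuclideanSpace.single i (1 : ℝ))) hPz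
  have e2 := congrArg (fun l => l (EuclideanSpace.single i (1 : ℝ))) hAz
  simp at e1 e2
  rw [hg]
  simp only [critNumerator, map_add, map_sub, map_mul, map_pow, eval_C]
  set w := graphPoint f x
  set p := fderiv ℝ f x (EuclideanSpace.single i 1)
  linear_combination eval w E * eval w (pderiv (Fin.last n) P) * e2
    - eval w E * eval w (pderiv (Fin.last n) A) * e1
    + eval w A * eval w (pderiv (Fin.last n) E) * e1
    - eval w (pderiv (Fin.last n) P) * (eval w (pderiv i.castSucc E)
      + eval w (pderiv (Fin.last n) E) * p) * hAv

lemma critNumerator_nondegenerate {n : ℕ} {f Ψ : EuclideanSpace ℝ (Fin n) → ℝ}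
    {x c : EuclideanSpace ℝ (Fin n)} (hf : ContDiffAt ℝ 2 f x)
    {P A E : MvPolynomial (Fin (n + 1)) ℝ} (hP : ∀ᶠ z in 𝓝 x, eval (graphPoint f z) P = 0)
    (hPy : eval (graphPoint f x) (pderiv (Fin.last n) P) ≠ 0)
    (hE : eval (graphPoint f x) E ≠ 0)
    (hΨ : Ψ =ᶠ[𝓝 x] fun z => eval (graphPoint f z) A / eval (graphPoint f z) E)
    (hcrit : gradient Ψ x = -c) (hdet : (fderiv ℝ (gradient Ψ) x).det ≠ 0) :
    (∀ i, eval (graphPoint f x) (critNumerator P A E (c i) i) = 0) ∧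
    ∀ v : Fin (n + 1) → ℝ, (∑ j, eval (graphPoint f x) (pderiv j P) * v j = 0) →
      (∀ i, ∑ j, eval (graphPoint f x) (pderiv j (critNumerator P A E (c i) i)) * v j = 0) →
      v = 0 := by
  have hfd : ∀ᶠ z in 𝓝 x, DifferentiableAt ℝ f z :=
    (hf.eventually (by simp)).mono fun z hz => hz.differentiableAt (by simp)
  have hf1 := hfd.self_of_nhds
  have hkey : ∀ i, (fun z => eval (graphPoint f z) (critNumerator P A E (c i) i)) =ᶠ[𝓝 x]
      fun z => eval (graphPoint f z) (pderiv (Fin.last n) P) * eval (graphPoint f z) E ^ 2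
        * (gradient Ψ z i + c i) := by
    intro i
    filter_upwards [hfd, hP.eventually_nhds, hΨ.eventually_nhds,
      (hasFDerivAt_eval_graphPoint hf1 E).continuousAt.eventually_ne hE] with z h1 h2 h3 h4
    exact eval_critNumerator_graphPoint h1 h2 h4 h3 (c i) i
  have hc : ∀ i, gradient Ψ x i + c i = 0 := by
    intro i; rw [hcrit]; simp
  refine ⟨fun i => ?_, fun v hv1 hv2 => ?_⟩
  · rw [(hkey i).eq_of_nhds, hc, mul_zero]
  have hΨ2 : ContDiffAt ℝ 2 Ψ x :=
    ((contDiffAt_eval_graphPoint hf A).fun_div (contDiffAt_eval_graphPoint hf E) hE).congr_of_eventuallyEq hΨ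
  have hgd : DifferentiableAt ℝ (gradient Ψ) x := by
    have h1 : DifferentiableAt ℝ (fderiv ℝ Ψ) x :=
      (hΨ2.fderiv_right (m := 1) (by norm_num)).differentiableAt (by simp)
    exact (InnerProductSpace.toDual ℝ (EuclideanSpace ℝ (Fin n))).symm.toContinuousLinearEquiv.differentiableAt.comp x h1
  let u : EuclideanSpace ℝ (Fin n) := WithLp.toLp 2 fun i => v i.castSucc
  have hvl : v (Fin.last n) = fderiv ℝ f x u := by
    have h1 := (hasFDerivAt_eval_graphPoint hf1 P).unique
      ((hasFDerivAt_const (0 : ℝ) x).congr_of_eventuallyEq hP)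
    have h2 := congrArg (fun l => l u) h1
    simp [u] at h2
    rw [Fin.sum_univ_castSucc] at hv1
    have : eval (graphPoint f x) (pderiv (Fin.last n) P) * (v (Fin.last n) - fderiv ℝ f x u) = 0 := by
      simp only [u]
      linear_combination hv1 - h2
    exact sub_eq_zero.1 ((mul_eq_zero.1 this).resolve_left hPy)
  have hu : fderiv ℝ (gradient Ψ) x u = 0 := by
    ext i
    have hm : DifferentiableAt ℝ (fun z => eval (graphPoint f z) (pderiv (Fin.last n) P)
        * eval (graphPoint f z) E ^ 2) x :=
      (hasFDerivAt_eval_graphPoint hf1 _).differentiableAt.fun_mul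
        ((hasFDerivAt_eval_graphPoint hf1 _).differentiableAt.fun_pow 2)
    have hgi : HasFDerivAt (fun z => gradient Ψ z i + c i)
        ((EuclideanSpace.proj (𝕜 := ℝ) i).comp (fderiv ℝ (gradient Ψ) x)) x :=
      ((EuclideanSpace.proj (𝕜 := ℝ) i).hasFDerivAt.comp x hgd.hasFDerivAt).add_const _
    have h1 := (hasFDerivAt_eval_graphPoint hf1 (critNumerator P A E (c i) i)).unique
      ((hm.hasFDerivAt.mul hgi).congr_of_eventuallyEq (hkey i))
    have h2 := congrArg (fun l => l u) h1
    have h3 := hv2 i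
    rw [Fin.sum_univ_castSucc, hvl] at h3
    simp [hc] at h2
    have h4 := h2.symm.trans h3
    simpa [hPy, hE] using h4
  have hu0 : u = 0 := by
    by_contra hne
    exact hdet (LinearMap.det_eq_zero_iff_ker_ne_bot.2 fun h => hne
      (LinearMap.ker_eq_bot'.1 h u hu))
  ext i
  refine Fin.lastCases ?_ (fun l => ?_) i
  · rw [hvl, hu0]; simp
  · exact congrArg (fun w : EuclideanSpace ℝ (Fin n) => w l) hu0
end

section
open Filter Topology MeasureTheory Metric

/-- The zero set of a real-analytic function that does not vanish identically on a connected open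
set is null. -/
lemma AnalyticOnNhd.measure_zero_setOf_eq_zero {E : Type*} [NormedAddCommGroup E] [NormedSpace ℝ E]
    [FiniteDimensional ℝ E] [MeasurableSpace E] [BorelSpace E] (μ : Measure E) [μ.IsAddHaarMeasure]
    {h : E → ℝ} {V : Set E} (hh : AnalyticOnNhd ℝ h V) (hV : IsOpen V) (hVc : IsPreconnected V)
    (hne : ∃ x ∈ V, h x ≠ 0) : μ {x ∈ V | h x = 0} = 0 := by
  have : ProperSpace E := FiniteDimensional.proper ℝ E
  refine measure_null_of_locally_null _ fun x₀ hx₀ => ?_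
  obtain ⟨R, hR, hRV⟩ := Metric.isOpen_iff.1 hV x₀ hx₀.1
  obtain ⟨a, ha, haR⟩ : ∃ a, h a ≠ 0 ∧ a ∈ ball x₀ R := by
    have h1 : ¬ ∀ᶠ z in 𝓝 x₀, h z = 0 := by
      intro h2
      obtain ⟨x, hx, hx0⟩ := hne
      exact hx0 (hh.eqOn_zero_of_preconnected_of_eventuallyEq_zero hVc hx₀.1 h2 hx)
    have h2 : ∃ᶠ z in 𝓝 x₀, h z ≠ 0 := by
      rw [Filter.Frequently]
      simpa using h1
    exact (h2.and_eventually (ball_mem_nhds x₀ hR)).exists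
  set v := a - x₀
  have hev : ∀ᶠ z in 𝓝 x₀, h (z + v) ≠ 0 ∧ z + v ∈ ball x₀ R := by
    have hc : Tendsto (fun z => z + v) (𝓝 x₀) (𝓝 a) :=
      (continuous_id.add continuous_const).tendsto' _ _ (by simp)
    exact hc.eventually ((((hh a (hRV haR)).continuousAt).eventually_ne ha).and
      (isOpen_ball.mem_nhds haR))
  obtain ⟨ε, hε, hball⟩ := Metric.eventually_nhds_iff_ball.1 (hev.and (ball_mem_nhds x₀ hR))
  have hcl : ∀ z ∈ closedBall x₀ (ε / 2), z ∈ ball x₀ ε := fun z hz =>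
    closedBall_subset_ball (by linarith) hz
  refine ⟨{z | z ∈ closedBall x₀ (ε / 2) ∧ h z = 0}, ?_, ?_⟩
  · filter_upwards [self_mem_nhdsWithin,
      mem_nhdsWithin_of_mem_nhds (closedBall_mem_nhds x₀ (half_pos hε))] with z hz1 hz2
    exact ⟨hz2, hz1.2⟩
  have hclosed : IsClosed {z | z ∈ closedBall x₀ (ε / 2) ∧ h z = 0} := by
    have : ContinuousOn h (closedBall x₀ (ε / 2)) := fun z hz =>
      (hh z (hRV (hball z (hcl z hz)).2)).continuousAt.continuousWithinAt
    exact this.preimage_isClosed_of_isClosed isClosed_closedBall (isClosed_singleton (x := (0 : ℝ)))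
  have key : ∀ᵐ y ∂μ, y ∈ {z | z ∈ closedBall x₀ (ε / 2) ∧ h z = 0}ᶜ := by
    refine ae_mem_of_ae_add_linearMap_mem
      ((1 : ℝ →L[ℝ] ℝ).smulRight v).toLinearMap volume μ hclosed.measurableSet.compl fun y => ?_
    simp only [ContinuousLinearMap.coe_coe, ContinuousLinearMap.smulRight_apply,
      one_apply_eq_self, Set.mem_compl_iff, Set.mem_ofPred]
    by_cases hex : ∃ t₀ : ℝ, y + t₀ • v ∈ closedBall x₀ (ε / 2)
    swap
    · push Not at hex
      exact Eventually.of_forall fun t ht => hex t ht.1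
    obtain ⟨t₀, ht₀⟩ := hex
    let ℓ : ℝ →ᵃ[ℝ] E := AffineMap.lineMap y (y + v)
    have hℓ : ∀ t : ℝ, ℓ t = y + t • v := fun t => by
      simp [ℓ, AffineMap.lineMap_apply, add_comm]
    have hℓc : Continuous ℓ := AffineMap.lineMap_continuous
    let J := ℓ ⁻¹' ball x₀ R
    have hJo : IsOpen J := isOpen_ball.preimage hℓc
    have hJc : IsPreconnected J := ((convex_ball x₀ R).affine_preimage ℓ).isPreconnected
    have hJa : AnalyticOnNhd ℝ (fun t : ℝ => h (y + t • v)) J := by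
      intro t ht
      refine AnalyticAt.fun_comp (g := h) (f := fun t : ℝ => y + t • v) (hh _ (hRV ?_)) ?_
      · rw [← hℓ]; exact ht
      · fun_prop
    have h1 := (hball _ (hcl _ ht₀)).1
    have h1J : t₀ + 1 ∈ J := by
      change ℓ (t₀ + 1) ∈ ball x₀ R
      rw [hℓ, add_smul, one_smul, ← add_assoc]
      exact h1.2
    have hcod : ∀ᶠ t in codiscreteWithin J, h (y + t • v) ≠ 0 := by
      refine (hJa.eqOn_zero_or_eventually_ne_zero_of_preconnected hJc).resolve_left fun h0 => ?_
      apply h1.1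
      have := h0 h1J
      simpa [add_smul, ← add_assoc] using this
    have hae : ∀ᵐ t ∂(volume.restrict J), h (y + t • v) ≠ 0 :=
      ae_restrict_le_codiscreteWithin hJo.measurableSet hcod
    rw [ae_restrict_iff' hJo.measurableSet] at hae
    filter_upwards [hae] with t ht h2
    refine ht ?_ h2.2
    change ℓ t ∈ ball x₀ R
    rw [hℓ]
    exact (hball _ (hcl _ h2.1)).2
  rw [← compl_compl {z | z ∈ closedBall x₀ (ε / 2) ∧ h z = 0}]
  exact mem_ae_iff.1 key
end

section
open MvPolynomial Filter Topology

/-- Numerator of the penalized function `(s ^ 3 * ‖∇f‖ ^ 2 + (f - s) ^ 2 + s ^ 6) / (r ^ 2 - ‖x‖ ^ 2)`,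
written on the hypersurface `P = 0`. -/
noncomputable def penaltyNum {R : Type*} [CommRing R] {n : ℕ} (P : MvPolynomial (Fin (n + 1)) R)
    (s : R) : MvPolynomial (Fin (n + 1)) R :=
  C (s ^ 3) * ∑ i : Fin n, pderiv i.castSucc P ^ 2
    + ((X (Fin.last n) - C s) ^ 2 + C (s ^ 6)) * pderiv (Fin.last n) P ^ 2

/-- Denominator matching `penaltyNum`. -/
noncomputable def penaltyDen {R : Type*} [CommRing R] {n : ℕ} (P : MvPolynomial (Fin (n + 1)) R)
    (r : R) : MvPolynomial (Fin (n + 1)) R :=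
  pderiv (Fin.last n) P ^ 2 * (C (r ^ 2) - ∑ i : Fin n, X i.castSucc ^ 2)

lemma map_penaltyNum {R S : Type*} [CommRing R] [CommRing S] (φ : R →+* S) {n : ℕ}
    (P : MvPolynomial (Fin (n + 1)) R) (s : R) :
    map φ (penaltyNum P s) = penaltyNum (map φ P) (φ s) := by
  simp [penaltyNum, pderiv_map]

lemma map_penaltyDen {R S : Type*} [CommRing R] [CommRing S] (φ : R →+* S) {n : ℕ}
    (P : MvPolynomial (Fin (n + 1)) R) (r : R) :
    map φ (penaltyDen P r) = penaltyDen (map φ P) (φ r) := by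
  simp [penaltyDen, pderiv_map]

lemma totalDegree_penaltyNum_le {R : Type*} [CommRing R] [Nontrivial R] {n d : ℕ} (hd : 0 < d)
    {P : MvPolynomial (Fin (n + 1)) R} (hP : P.totalDegree ≤ d) (s : R) :
    (penaltyNum P s).totalDegree ≤ 2 * d := by
  have h3 : ∀ j, (pderiv j P ^ 2).totalDegree ≤ 2 * (d - 1) := fun j =>
    (totalDegree_pow _ _).trans (Nat.mul_le_mul_left 2
      ((totalDegree_pderiv_le j P).trans (by omega)))
  refine (totalDegree_add _ _).trans (max_le ?_ ?_)
  · refine (totalDegree_mul _ _).trans ?_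
    rw [totalDegree_C, zero_add]
    exact (totalDegree_finsetSum_le fun i _ => h3 _).trans (by omega)
  · refine (totalDegree_mul _ _).trans ?_
    have h1 : ((X (Fin.last n) - C s) ^ 2 + C (s ^ 6) :
        MvPolynomial (Fin (n + 1)) R).totalDegree ≤ 2 := by
      refine (totalDegree_add _ _).trans (max_le ((totalDegree_pow _ _).trans ?_) (by rw [totalDegree_C]; omega))
      have : (X (Fin.last n) - C s : MvPolynomial (Fin (n + 1)) R).totalDegree ≤ 1 :=
        (totalDegree_sub _ _).trans (max_le (by simp) (by simp))
      omega
    have := h3 (Fin.last n)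
    omega

lemma totalDegree_penaltyDen_le {R : Type*} [CommRing R] [Nontrivial R] {n d : ℕ} (hd : 0 < d)
    {P : MvPolynomial (Fin (n + 1)) R} (hP : P.totalDegree ≤ d) (r : R) :
    (penaltyDen P r).totalDegree ≤ 2 * d := by
  have h3 : ∀ j, (pderiv j P ^ 2).totalDegree ≤ 2 * (d - 1) := fun j =>
    (totalDegree_pow _ _).trans (Nat.mul_le_mul_left 2
      ((totalDegree_pderiv_le j P).trans (by omega)))
  refine (totalDegree_mul _ _).trans ?_
  have h1 : (C (r ^ 2) - ∑ i : Fin n, X i.castSucc ^ 2 :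
      MvPolynomial (Fin (n + 1)) R).totalDegree ≤ 2 := by
    refine (totalDegree_sub _ _).trans (max_le (by rw [totalDegree_C]; omega) (totalDegree_finsetSum_le fun i _ => ?_))
    exact (totalDegree_pow _ _).trans (by simp)
  have := h3 (Fin.last n)
  omega

/-- Coordinates of nondegenerate critical points of the penalized function are roots of a fixed
polynomial of controlled degree. -/
lemma exists_eval₂_eq_zero_of_critical {n d : ℕ} (hd : 0 < d) {P : MvPolynomial (Fin (n + 1)) ℝ}
    (hP : P.totalDegree ≤ d) (r : ℝ) (c : Fin n → ℝ) (i₀ : Fin (n + 1)) :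
    ∃ Q : Polynomial (Polynomial ℝ), Q ≠ 0 ∧ Q.natDegree ≤ (5 * d) ^ (n + 1) ∧
      ∀ (s : ℝ) (w : Fin (n + 1) → ℝ), eval w P = 0 →
        (∀ i, eval w (critNumerator P (penaltyNum P s) (penaltyDen P r) (s ^ 6 * c i) i) = 0) →
        (∀ v : Fin (n + 1) → ℝ, ∑ j, eval w (pderiv j P) * v j = 0 →
          (∀ i, ∑ j, eval w (pderiv j
            (critNumerator P (penaltyNum P s) (penaltyDen P r) (s ^ 6 * c i) i)) * v j = 0) →
          v = 0) →
        Q.eval₂ (Polynomial.evalRingHom s) (w i₀) = 0 := by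
  set P' : MvPolynomial (Fin (n + 1)) (Polynomial ℝ) := map Polynomial.C P with hP'
  have hdP' : P'.totalDegree ≤ d := (Finset.sup_mono (support_map_subset ..)).trans hP
  let N : Fin n → MvPolynomial (Fin (n + 1)) (Polynomial ℝ) := fun i =>
    critNumerator P' (penaltyNum P' Polynomial.X) (penaltyDen P' (Polynomial.C r))
      (Polynomial.X ^ 6 * Polynomial.C (c i)) i
  let F : Fin (n + 1) → MvPolynomial (Fin (n + 1)) (Polynomial ℝ) := Fin.snoc N P'
  have hF : ∀ i, (F i).totalDegree < 5 * d := by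
    intro i
    refine Fin.lastCases ?_ (fun l => ?_) i
    · simp only [F, Fin.snoc_last]; omega
    · simp only [F, Fin.snoc_castSucc]
      exact totalDegree_critNumerator_lt hd hdP' (totalDegree_penaltyNum_le hd hdP' _)
        (totalDegree_penaltyDen_le hd hdP' _) _ _
  obtain ⟨Q, hQ, hdeg, hroot⟩ := exists_eval₂_eq_zero_of_nondegenerate hF i₀
  refine ⟨Q, hQ, by simpa using hdeg, fun s w hw0 hw1 hw2 => ?_⟩
  have hmP : map (Polynomial.evalRingHom s) P' = P := by
    rw [hP', MvPolynomial.map_map]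
    convert map_id P
    ext; simp
  have hmN : ∀ i, map (Polynomial.evalRingHom s) (N i) =
      critNumerator P (penaltyNum P s) (penaltyDen P r) (s ^ 6 * c i) i := by
    intro i
    simp [N, map_critNumerator, map_penaltyNum, map_penaltyDen, hmP, mul_comm (c i)]
  refine hroot s w (fun i => ?_) fun v hv => hw2 v ?_ fun i => ?_
  · rw [eval₂_eq_eval_map]
    refine Fin.lastCases ?_ (fun l => ?_) i
    · simp only [F, Fin.snoc_last, hmP, hw0]
    · simp only [F, Fin.snoc_castSucc, hmN, hw1]
  · simpa [F, eval₂_eq_eval_map, ← pderiv_map, hmP] using hv (Fin.last n)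
  · simpa [F, eval₂_eq_eval_map, ← pderiv_map, hmN] using hv i.castSucc
end

section
open Filter Topology MeasureTheory Metric
open scoped Pointwise

lemma exists_forall_det_ne_zero {E : Type*} [NormedAddCommGroup E] [NormedSpace ℝ E]
    [FiniteDimensional ℝ E] {V N : Set E} {Θ : ℕ → E → E}
    (hΘ : ∀ j, ∀ x ∈ V, DifferentiableAt ℝ (Θ j) x) [MeasurableSpace E] [BorelSpace E]
    (μ : Measure E) [μ.IsAddHaarMeasure] (hN : μ N = 0) (hNV : N ⊆ V) {σ : ℕ → ℝ}
    (hσ : ∀ j, σ j ≠ 0) :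
    ∃ c : E, ‖c‖ < 1 ∧ ∀ j, ∀ x ∈ V, Θ j x = -(σ j • c) →
      (fderiv ℝ (Θ j) x).det ≠ 0 ∧ x ∉ N := by
  let B : ℕ → Set E := fun j => Θ j '' {x ∈ V | (fderiv ℝ (Θ j) x).det = 0} ∪ Θ j '' N
  have hB : ∀ j, μ (B j) = 0 := fun j => by
    refine measure_union_null ?_ ?_
    · exact addHaar_image_eq_zero_of_det_fderivWithin_eq_zero μ
        (fun x hx => (hΘ j x hx.1).hasFDerivAt.hasFDerivWithinAt) fun x hx => hx.2
    · exact addHaar_image_eq_zero_of_differentiableOn_of_addHaar_eq_zero μ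
        (fun x hx => (hΘ j x (hNV hx)).differentiableWithinAt) hN
  have hB' : μ (⋃ j, (-(σ j)⁻¹) • B j) = 0 := by
    refine measure_iUnion_null fun j => ?_
    rw [Measure.addHaar_smul, hB, mul_zero]
  obtain ⟨c, hc, hcB⟩ : ∃ c ∈ ball (0 : E) 1, c ∉ ⋃ j, (-(σ j)⁻¹) • B j := by
    by_contra! h
    have := measure_mono_null h hB'
    exact (measure_ball_pos μ (0 : E) one_pos).ne' this
  refine ⟨c, by simpa using hc, fun j x hx h => ?_⟩
  by_contra hcon
  refine hcB (Set.mem_iUnion.2 ⟨j, ⟨Θ j x, ?_, ?_⟩⟩)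
  · by_cases h1 : x ∈ N
    · exact Or.inr ⟨x, h1, rfl⟩
    · refine Or.inl ⟨x, ⟨hx, ?_⟩, rfl⟩
      by_contra h2
      exact hcon ⟨h2, h1⟩
  · simp [h, smul_smul, hσ j]
end

section
open Filter Topology Metric

lemma exists_isLocalMin_div_add {E : Type*} [NormedAddCommGroup E] [ProperSpace E] {A L : E → ℝ}
    {r η B : ℝ} (hη : 0 < η) (hA : ContinuousOn A (ball 0 r)) (hL : ContinuousOn L (ball 0 r))
    (hηA : ∀ z ∈ ball (0 : E) r, η ≤ A z) (hBL : ∀ z ∈ ball (0 : E) r, -B ≤ L z) {x : E}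
    (hx : x ∈ ball (0 : E) r) :
    ∃ y ∈ ball (0 : E) r, IsLocalMin (fun z => A z / (r ^ 2 - ‖z‖ ^ 2) + L z) y ∧
      A y / (r ^ 2 - ‖y‖ ^ 2) + L y ≤ A x / (r ^ 2 - ‖x‖ ^ 2) + L x := by
  set F : E → ℝ := fun z => A z / (r ^ 2 - ‖z‖ ^ 2) + L z
  have hr : 0 < r := (norm_nonneg _).trans_lt (mem_ball_zero_iff.1 hx)
  have hρ : ∀ z ∈ ball (0 : E) r, 0 < r ^ 2 - ‖z‖ ^ 2 := fun z hz => by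
    have : ‖z‖ < r := mem_ball_zero_iff.1 hz
    nlinarith [norm_nonneg z]
  have hF : ContinuousOn F (ball 0 r) :=
    (hA.div (by fun_prop) fun z hz => (hρ z hz).ne').add hL
  have hlow : ∀ z ∈ ball (0 : E) r, η / (r ^ 2 - ‖z‖ ^ 2) ≤ F z + B := fun z hz => by
    have h1 := hBL z hz
    have h2 : η / (r ^ 2 - ‖z‖ ^ 2) ≤ A z / (r ^ 2 - ‖z‖ ^ 2) :=
      div_le_div_of_nonneg_right (hηA z hz) (hρ z hz).le
    simp only [F]
    linarith
  have hpos : 0 < F x + B := (div_pos hη (hρ x hx)).trans_le (hlow x hx)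
  set δ := η / (F x + B)
  have hδ : 0 < δ := div_pos hη hpos
  have hsub : ∀ z ∈ ball (0 : E) r, F z ≤ F x → ‖z‖ ^ 2 ≤ r ^ 2 - δ := fun z hz h => by
    have h1 := hlow z hz
    have h2 : η ≤ (F x + B) * (r ^ 2 - ‖z‖ ^ 2) := by
      rw [← div_le_iff₀ (hρ z hz)]; linarith
    have h3 : δ ≤ r ^ 2 - ‖z‖ ^ 2 := by
      rw [div_le_iff₀' hpos]; exact h2
    linarith
  let K : Set E := {z | ‖z‖ ^ 2 ≤ r ^ 2 - δ}
  have hKb : K ⊆ ball 0 r := by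
    intro z hz
    replace hz : ‖z‖ ^ 2 ≤ r ^ 2 - δ := hz
    rw [mem_ball_zero_iff]
    exact lt_of_pow_lt_pow_left₀ 2 hr.le (by linarith)
  have hK : IsCompact K := by
    refine isCompact_of_isClosed_isBounded ?_ (isBounded_ball.subset hKb)
    exact isClosed_le (by fun_prop) (by fun_prop)
  obtain ⟨y, hyK, hy⟩ := hK.exists_isMinOn ⟨x, hsub x hx le_rfl⟩ (hF.mono hKb)
  have hyx : F y ≤ F x := hy (hsub x hx le_rfl)
  refine ⟨y, hKb hyK, ?_, hyx⟩
  filter_upwards [isOpen_ball.mem_nhds (hKb hyK)] with z hz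
  by_cases h : F z ≤ F x
  · exact hy (hsub z hz h)
  · exact hyx.trans (not_le.1 h).le
end

section
open MvPolynomial Filter Topology Metric

lemma penalty_estimates {κ : ℕ} (hκ : 2 ≤ κ) {s a b y : ℝ} (hs : 0 < s) (hs1 : s ≤ 1) (ha : 0 ≤ a)
    (hG : a ^ κ ≤ s ^ (κ - 1))
    (h : s ^ 3 * b ^ 2 + (y - s) ^ 2 ≤ 4 * (s ^ 3 * a ^ 2 + s ^ 6)) :
    |y - s| ≤ 3 * s ^ 2 ∧ b ^ κ ≤ 8 ^ κ * s ^ (κ - 1) := by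
  have h3 : 0 < s ^ 3 := by positivity
  have ha2 : a ^ 2 ≤ s := by
    rw [← pow_le_pow_iff_left₀ (by positivity) hs.le (n := κ) (by omega)]
    calc (a ^ 2) ^ κ = (a ^ κ) ^ 2 := by ring
      _ ≤ (s ^ (κ - 1)) ^ 2 := by gcongr
      _ = s ^ ((κ - 1) * 2) := by rw [pow_mul]
      _ ≤ s ^ κ := pow_le_pow_of_le_one hs.le hs1 (by omega)
  constructor
  · refine abs_le_of_sq_le_sq ?_ (by positivity)
    have h1 : s ^ 3 * a ^ 2 ≤ s ^ 3 * s := by gcongr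
    have h2 : s ^ 6 ≤ s ^ 4 := pow_le_pow_of_le_one hs.le hs1 (by omega)
    have h4 : 0 ≤ s ^ 3 * b ^ 2 := by positivity
    nlinarith
  · refine abs_le_of_sq_le_sq' ?_ (by positivity) |>.2
    have hb2 : b ^ 2 ≤ 8 * max (a ^ 2) (s ^ 3) := by
      have h1 : s ^ 3 * b ^ 2 ≤ s ^ 3 * (4 * (a ^ 2 + s ^ 3)) := by nlinarith [sq_nonneg (y - s)]
      have h2 := le_of_mul_le_mul_left h1 h3
      linarith [le_max_left (a ^ 2) (s ^ 3), le_max_right (a ^ 2) (s ^ 3)]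
    have hmax : max (a ^ 2) (s ^ 3) ^ κ ≤ (s ^ (κ - 1)) ^ 2 := by
      rcases max_cases (a ^ 2) (s ^ 3) with ⟨h', -⟩ | ⟨h', -⟩ <;> rw [h']
      · calc (a ^ 2) ^ κ = (a ^ κ) ^ 2 := by ring
          _ ≤ (s ^ (κ - 1)) ^ 2 := by gcongr
      · rw [← pow_mul, ← pow_mul]
        exact pow_le_pow_of_le_one hs.le hs1 (by omega)
    calc (b ^ κ) ^ 2 = (b ^ 2) ^ κ := by ring
      _ ≤ (8 * max (a ^ 2) (s ^ 3)) ^ κ := by gcongr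
      _ = 8 ^ κ * max (a ^ 2) (s ^ 3) ^ κ := by rw [mul_pow]
      _ ≤ 8 ^ κ * (s ^ (κ - 1)) ^ 2 := by gcongr
      _ ≤ (8 ^ κ * 8 ^ κ) * (s ^ (κ - 1)) ^ 2 := by
        gcongr
        exact le_mul_of_one_le_left (by positivity) (one_le_pow₀ (by norm_num))
      _ = (8 ^ κ * s ^ (κ - 1)) ^ 2 := by ring

lemma pderiv_add_mul_gradient_eq_zero {n : ℕ} {f : EuclideanSpace ℝ (Fin n) → ℝ}
    {x : EuclideanSpace ℝ (Fin n)} (hf : DifferentiableAt ℝ f x) {P : MvPolynomial (Fin (n + 1)) ℝ}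
    (hP : ∀ᶠ z in 𝓝 x, eval (graphPoint f z) P = 0) (i : Fin n) :
    eval (graphPoint f x) (pderiv i.castSucc P)
      + eval (graphPoint f x) (pderiv (Fin.last n) P) * gradient f x i = 0 := by
  have h1 := hasFDerivAt_eval_graphPoint hf P
  have h2 : HasFDerivAt (fun x => eval (graphPoint f x) P)
      (0 : EuclideanSpace ℝ (Fin n) →L[ℝ] ℝ) x :=
    (hasFDerivAt_const (0 : ℝ) x).congr_of_eventuallyEq hP
  have h3 := congrArg (fun L => L (EuclideanSpace.single i (1 : ℝ))) (h1.unique h2)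
  have h4 : fderiv ℝ f x (EuclideanSpace.single i (1 : ℝ)) = gradient f x i := by
    rw [← inner_gradient_left, EuclideanSpace.inner_single_right]
    simp
  simpa [h4, Pi.single_apply] using h3

/-- The penalized function is the quotient of `penaltyNum` by `penaltyDen` on the graph. -/
lemma penalty_eq_div {n : ℕ} {f : EuclideanSpace ℝ (Fin n) → ℝ}
    {x : EuclideanSpace ℝ (Fin n)} (hf : DifferentiableAt ℝ f x) {P : MvPolynomial (Fin (n + 1)) ℝ}
    (hP : ∀ᶠ z in 𝓝 x, eval (graphPoint f z) P = 0)
    (hPy : eval (graphPoint f x) (pderiv (Fin.last n) P) ≠ 0) (s r : ℝ) :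
    (s ^ 3 * ‖gradient f x‖ ^ 2 + (f x - s) ^ 2 + s ^ 6) / (r ^ 2 - ‖x‖ ^ 2) =
      eval (graphPoint f x) (penaltyNum P s) / eval (graphPoint f x) (penaltyDen P r) := by
  have h1 : ∀ i : Fin n, eval (graphPoint f x) (pderiv i.castSucc P) ^ 2 =
      eval (graphPoint f x) (pderiv (Fin.last n) P) ^ 2 * gradient f x i ^ 2 := fun i => by
    have := pderiv_add_mul_gradient_eq_zero hf hP i
    rw [eq_neg_of_add_eq_zero_left this]
    ring
  have h2 : eval (graphPoint f x) (penaltyNum P s) =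
      eval (graphPoint f x) (pderiv (Fin.last n) P) ^ 2 *
        (s ^ 3 * ‖gradient f x‖ ^ 2 + (f x - s) ^ 2 + s ^ 6) := by
    simp only [penaltyNum, map_add, map_mul, map_sum, map_pow, h1, ← Finset.mul_sum,
      EuclideanSpace.real_norm_sq_eq, eval_C, map_sub, eval_X]
    simp only [graphPoint, Fin.snoc_last]
    ring
  have h3 : eval (graphPoint f x) (penaltyDen P r) =
      eval (graphPoint f x) (pderiv (Fin.last n) P) ^ 2 * (r ^ 2 - ‖x‖ ^ 2) := by
    simp only [penaltyDen, map_mul, map_sum, map_pow, EuclideanSpace.real_norm_sq_eq, eval_C,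
      map_sub, eval_X]
    simp [graphPoint]
  rw [h2, h3, mul_div_mul_left _ _ (pow_ne_zero 2 hPy)]

lemma contDiffAt_gradient {n : ℕ} {f : EuclideanSpace ℝ (Fin n) → ℝ}
    {x : EuclideanSpace ℝ (Fin n)} {m N : WithTop ℕ∞} (hf : ContDiffAt ℝ N f x) (h : m + 1 ≤ N) :
    ContDiffAt ℝ m (gradient f) x :=
  (InnerProductSpace.toDual ℝ (EuclideanSpace ℝ (Fin n))).symm.contDiff.contDiffAt.comp x
    (hf.fderiv_right h)

lemma false_of_gradient_small_seq {n d κ : ℕ} (hd : 0 < d) (hκ : (5 * d) ^ (n + 1) < κ)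
    {f : EuclideanSpace ℝ (Fin n) → ℝ} {r : ℝ} (hr : 0 < r) (hr1 : r ≤ 1)
    (hf : AnalyticOnNhd ℝ f (ball 0 r)) {P : MvPolynomial (Fin (n + 1)) ℝ}
    (hP : P.totalDegree ≤ d) (hPf : ∀ x ∈ ball 0 r, eval (graphPoint f x) P = 0)
    (hPy : ∃ x ∈ ball 0 r, eval (graphPoint f x) (pderiv (Fin.last n) P) ≠ 0)
    {x : ℕ → EuclideanSpace ℝ (Fin n)} (hx : ∀ j, ‖x j‖ ≤ r / 2) (hs : ∀ j, 0 < f (x j))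
    (hs1 : ∀ j, f (x j) ≤ 1) (hs0 : Tendsto (fun j => f (x j)) atTop (𝓝 0))
    (hG : ∀ j, ‖gradient f (x j)‖ ^ κ ≤ f (x j) ^ (κ - 1)) : False := by
  set s : ℕ → ℝ := fun j => f (x j)
  let A : ℕ → EuclideanSpace ℝ (Fin n) → ℝ := fun j z =>
    s j ^ 3 * ‖gradient f z‖ ^ 2 + (f z - s j) ^ 2 + s j ^ 6
  let Ψ : ℕ → EuclideanSpace ℝ (Fin n) → ℝ := fun j z => A j z / (r ^ 2 - ‖z‖ ^ 2)
  have hκ2 : 2 ≤ κ := by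
    have : 1 ≤ (5 * d) ^ (n + 1) := Nat.one_le_pow _ _ (by omega)
    omega
  have hfc : ∀ z ∈ ball (0 : EuclideanSpace ℝ (Fin n)) r, ContDiffAt ℝ 3 f z := fun z hz =>
    (hf z hz).contDiffAt
  have hρ : ∀ z ∈ ball (0 : EuclideanSpace ℝ (Fin n)) r, 0 < r ^ 2 - ‖z‖ ^ 2 := fun z hz => by
    have : ‖z‖ < r := mem_ball_zero_iff.1 hz
    nlinarith [norm_nonneg z]
  have hAc : ∀ j, ∀ z ∈ ball (0 : EuclideanSpace ℝ (Fin n)) r, ContDiffAt ℝ 2 (A j) z := by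
    intro j z hz
    have h1 := contDiffAt_gradient (m := 2) (hfc z hz) (by norm_num)
    have h2 := (hfc z hz).of_le (m := 2) (by norm_num)
    exact ((contDiffAt_const.mul (h1.norm_sq ℝ)).add ((h2.sub contDiffAt_const).pow 2)).add
      contDiffAt_const
  have hΨc : ∀ j, ∀ z ∈ ball (0 : EuclideanSpace ℝ (Fin n)) r, ContDiffAt ℝ 2 (Ψ j) z := by
    intro j z hz
    exact (hAc j z hz).fun_div (contDiffAt_const.sub (contDiffAt_id.norm_sq ℝ)) (hρ z hz).ne'
  have hball : ∀ z ∈ ball (0 : EuclideanSpace ℝ (Fin n)) r,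
      ∀ᶠ w in 𝓝 z, w ∈ ball (0 : EuclideanSpace ℝ (Fin n)) r := fun z hz =>
    isOpen_ball.mem_nhds hz
  have hnull : MeasureTheory.volume {z ∈ ball (0 : EuclideanSpace ℝ (Fin n)) r |
      eval (graphPoint f z) (pderiv (Fin.last n) P) = 0} = 0 := by
    refine AnalyticOnNhd.measure_zero_setOf_eq_zero _ (fun z hz => ?_) isOpen_ball
      (convex_ball _ _).isPreconnected hPy
    refine (AnalyticOnNhd.eval_mvPolynomial (𝕜 := ℝ) (pderiv (Fin.last n) P) _
      (Set.mem_univ _)).comp_of_eq (f := graphPoint f) (x := z) ?_ rfl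
    rw [analyticAt_pi_iff]
    refine fun i => Fin.lastCases ?_ (fun l => ?_) i
    · simpa [graphPoint] using hf z hz
    · simpa [graphPoint] using
        (EuclideanSpace.proj l : EuclideanSpace ℝ (Fin n) →L[ℝ] ℝ).analyticAt z
  obtain ⟨c, hc, hcj⟩ := exists_forall_det_ne_zero (Θ := fun j => gradient (Ψ j))
    (fun j z hz => (contDiffAt_gradient (m := 1) (hΨc j z hz) (by norm_num)).differentiableAt
      (by norm_num)) MeasureTheory.volume hnull (fun z hz => hz.1) (σ := fun j => s j ^ 6)
    (fun j => (pow_pos (hs j) 6).ne')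
  have hxb : ∀ j, x j ∈ ball (0 : EuclideanSpace ℝ (Fin n)) r := fun j => by
    rw [mem_ball_zero_iff]; linarith [hx j]
  have hcz : ∀ z ∈ ball (0 : EuclideanSpace ℝ (Fin n)) r, |inner ℝ c z| ≤ r := fun z hz => by
    have h1 : ‖z‖ < r := mem_ball_zero_iff.1 hz
    have h2 := abs_real_inner_le_norm c z
    nlinarith [norm_nonneg z, norm_nonneg c]
  have hmin : ∀ j, ∃ y ∈ ball (0 : EuclideanSpace ℝ (Fin n)) r,
      gradient (Ψ j) y = -(s j ^ 6 • c) ∧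
      |f y - s j| ≤ 3 * s j ^ 2 ∧ ‖gradient f y‖ ^ κ ≤ 8 ^ κ * s j ^ (κ - 1) := by
    intro j
    have hsj : 0 < s j := hs j
    have hs6 : 0 < s j ^ 6 := pow_pos hsj 6
    obtain ⟨y, hy, hloc, hle⟩ := exists_isLocalMin_div_add (A := A j)
      (L := fun z => s j ^ 6 * inner ℝ c z) (B := s j ^ 6 * r) hs6
      (fun z hz => (hAc j z hz).continuousAt.continuousWithinAt) (by fun_prop)
      (fun z _ => by
        have h1 : 0 ≤ s j ^ 3 * ‖gradient f z‖ ^ 2 := by positivity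
        have h2 := sq_nonneg (f z - s j)
        simp only [A]
        linarith)
      (fun z hz => by
        have := (abs_le.1 (hcz z hz)).1
        nlinarith) (hxb j)
    refine ⟨y, hy, ?_, penalty_estimates hκ2 hsj (hs1 j) (norm_nonneg _) (hG j) ?_⟩
    · have h1 := hloc.fderiv_eq_zero
      have h2 : HasGradientAt (Ψ j) (gradient (Ψ j) y) y :=
        ((hΨc j y hy).differentiableAt (by norm_num)).hasGradientAt
      have h3 : HasFDerivAt (fun z => s j ^ 6 * inner ℝ c z) (s j ^ 6 • innerSL ℝ c) y :=
        (innerSL ℝ c).hasFDerivAt.const_mul _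
      have h4 := (h2.hasFDerivAt.add h3).fderiv
      rw [eq_neg_iff_add_eq_zero, ← inner_self_eq_zero (𝕜 := ℝ)]
      have h5 := congrArg (fun T => T (gradient (Ψ j) y + s j ^ 6 • c)) (h4.symm.trans h1)
      rw [inner_add_left, real_inner_smul_left]
      simpa using h5
    · have hA : ∀ z, A j z = s j ^ 3 * ‖gradient f z‖ ^ 2 + (f z - s j) ^ 2 + s j ^ 6 :=
        fun z => rfl
      have hy1 := (abs_le.1 (hcz y hy)).1
      have hx1 := (abs_le.1 (hcz _ (hxb j))).2
      have h1 : A j y / (r ^ 2 - ‖y‖ ^ 2) ≤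
          A j (x j) / (r ^ 2 - ‖x j‖ ^ 2) + 2 * s j ^ 6 * r := by
        nlinarith
      have hρx : r ^ 2 / 2 ≤ r ^ 2 - ‖x j‖ ^ 2 := by
        nlinarith [hx j, norm_nonneg (x j)]
      have hAx : A j (x j) = s j ^ 3 * ‖gradient f (x j)‖ ^ 2 + s j ^ 6 := by
        simp [hA, s]
      have hAx0 : 0 ≤ A j (x j) := by rw [hAx]; positivity
      have h2 : A j (x j) / (r ^ 2 - ‖x j‖ ^ 2) ≤ A j (x j) / (r ^ 2 / 2) :=
        div_le_div_of_nonneg_left hAx0 (by positivity) hρx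
      have h3 : A j y ≤ (A j (x j) / (r ^ 2 / 2) + 2 * s j ^ 6 * r) * (r ^ 2 - ‖y‖ ^ 2) := by
        rw [← div_le_iff₀ (hρ y hy)]; linarith
      have h4 : A j y ≤ (A j (x j) / (r ^ 2 / 2) + 2 * s j ^ 6 * r) * r ^ 2 := by
        refine h3.trans (mul_le_mul_of_nonneg_left (by nlinarith [sq_nonneg (‖y‖)]) (by positivity))
      have h5 : (A j (x j) / (r ^ 2 / 2) + 2 * s j ^ 6 * r) * r ^ 2 =
          2 * A j (x j) + 2 * s j ^ 6 * r ^ 3 := by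
        field_simp
      have h6 : s j ^ 6 * r ^ 3 ≤ s j ^ 6 * 1 :=
        mul_le_mul_of_nonneg_left (pow_le_one₀ hr.le hr1) hs6.le
      rw [h5, hAx, hA] at h4
      have h7 : 0 ≤ s j ^ 3 * ‖gradient f (x j)‖ ^ 2 := by positivity
      linarith
  choose y hyb hycrit hyf hyG using hmin
  choose Q hQ0 hQdeg hQroot using fun i₀ =>
    exists_eval₂_eq_zero_of_critical hd hP r (fun i => c i) i₀
  have hPy' : ∀ j, eval (graphPoint f (y j)) (pderiv (Fin.last n) P) ≠ 0 := fun j h0 =>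
    (hcj j (y j) (hyb j) (hycrit j)).2 ⟨hyb j, h0⟩
  have hPev : ∀ j, ∀ᶠ z in 𝓝 (y j), eval (graphPoint f z) P = 0 := fun j =>
    (hball _ (hyb j)).mono hPf
  refine false_of_algebraic_seq hκ hQ0 hQdeg hs hs0 (P := P) (x := fun j i => y j i)
    (y := fun j => f (y j)) (C := 8 ^ κ) (fun j i => ?_) (fun j => ?_) (fun j i => ?_)
    (fun j => hPf _ (hyb j)) hPy' (fun j i => ?_)
  · have h1 : |y j i| ≤ ‖y j‖ := by
      simpa using PiLp.norm_apply_le (y j) i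
    have h2 : ‖y j‖ < r := mem_ball_zero_iff.1 (hyb j)
    have h3 : (1 : ℝ) ≤ 8 ^ κ := one_le_pow₀ (by norm_num)
    linarith
  · refine (hyf j).trans (mul_le_mul_of_nonneg_right ?_ (sq_nonneg _))
    calc (3 : ℝ) ≤ 8 ^ 1 := by norm_num
      _ ≤ 8 ^ κ := pow_le_pow_right₀ (by norm_num) (by omega)
  · have hE : eval (graphPoint f (y j)) (penaltyDen P r) ≠ 0 := by
      have h3 : eval (graphPoint f (y j)) (penaltyDen P r) =
          eval (graphPoint f (y j)) (pderiv (Fin.last n) P) ^ 2 * (r ^ 2 - ‖y j‖ ^ 2) := by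
        simp only [penaltyDen, map_mul, map_sum, map_pow, EuclideanSpace.real_norm_sq_eq, eval_C,
          map_sub, eval_X]
        simp [graphPoint]
      rw [h3]
      exact mul_ne_zero (pow_ne_zero 2 (hPy' j)) (hρ _ (hyb j)).ne'
    have hΨE : Ψ j =ᶠ[𝓝 (y j)] fun z => eval (graphPoint f z) (penaltyNum P (s j)) /
        eval (graphPoint f z) (penaltyDen P r) := by
      have hc1 := (hasFDerivAt_eval_graphPoint ((hfc _ (hyb j)).differentiableAt (by norm_num))
        (pderiv (Fin.last n) P)).continuousAt.eventually_ne (hPy' j)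
      filter_upwards [hball _ (hyb j), (hPev j).eventually_nhds, hc1] with z hz1 hz2 hz3
      exact penalty_eq_div ((hfc _ hz1).differentiableAt (by norm_num)) hz2 hz3 _ _
    obtain ⟨h1, h2⟩ := critNumerator_nondegenerate (c := s j ^ 6 • c)
      ((hfc _ (hyb j)).of_le (by norm_num)) (hPev j) (hPy' j) hE hΨE (hycrit j)
      (hcj j (y j) (hyb j) (hycrit j)).1
    exact hQroot i (s j) (graphPoint f (y j)) (hPf _ (hyb j)) (fun l => h1 l) fun v hv hv' =>
      h2 v hv fun l => hv' l
  · have h1 := pderiv_add_mul_gradient_eq_zero ((hfc _ (hyb j)).differentiableAt (by norm_num))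
      (hPev j) i
    have h2 : |gradient f (y j) i| ^ κ ≤ 8 ^ κ * s j ^ (κ - 1) := by
      refine le_trans ?_ (hyG j)
      gcongr
      simpa using PiLp.norm_apply_le (gradient f (y j)) i
    change |eval (graphPoint f (y j)) _| ^ κ ≤ 8 ^ κ * (s j ^ (κ - 1) *
      |eval (graphPoint f (y j)) _| ^ κ)
    rw [eq_neg_of_add_eq_zero_left h1, abs_neg, abs_mul, mul_pow, ← mul_assoc, mul_comm]
    gcongr
end

section
open MvPolynomial Filter Topology Metric

lemma totalDegree_aeval_le_of_le_one {R σ τ : Type*} [CommRing R] {g : σ → MvPolynomial τ R}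
    (hg : ∀ i, (g i).totalDegree ≤ 1) (p : MvPolynomial σ R) :
    (aeval g p).totalDegree ≤ p.totalDegree := by
  rw [aeval_def, eval₂_eq]
  refine totalDegree_finsetSum_le fun m hm => ?_
  refine (totalDegree_mul _ _).trans ?_
  rw [algebraMap_eq, totalDegree_C, zero_add]
  refine (totalDegree_finsetProd _ _).trans (le_trans ?_ (le_totalDegree hm))
  refine Finset.sum_le_sum fun i _ => (totalDegree_pow _ _).trans ?_
  simpa using Nat.mul_le_mul_left (m i) (hg i)

lemma eq_C_of_pderiv_eq_zero {σ : Type*} {p : MvPolynomial σ ℝ} (h : ∀ i, pderiv i p = 0) :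
    p = C (coeff 0 p) := by
  rw [← totalDegree_eq_zero_iff_eq_C, totalDegree_eq_zero_iff]
  intro m hm i
  by_contra hi
  have h1 : m - Finsupp.single i 1 + Finsupp.single i 1 = m :=
    tsub_add_cancel_of_le (by rw [Finsupp.single_le_iff]; omega)
  have h2 := congrArg (coeff (m - Finsupp.single i 1)) (h i)
  rw [coeff_pderiv, h1, coeff_zero] at h2
  rcases mul_eq_zero.1 h2 with h3 | h3
  · exact (mem_support_iff.1 hm) h3
  · exact absurd h3 (by positivity)

/-- A polynomial of minimal degree vanishing on a graph depends on the last variable along it. -/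
lemma exists_pderiv_last_ne_zero {n d : ℕ} {f : EuclideanSpace ℝ (Fin n) → ℝ} {r : ℝ} (hr : 0 < r)
    (hf : ∀ x ∈ ball (0 : EuclideanSpace ℝ (Fin n)) r, DifferentiableAt ℝ f x)
    {P : MvPolynomial (Fin (n + 1)) ℝ} (hP0 : P ≠ 0) (hP : P.totalDegree ≤ d)
    (hPf : ∀ x ∈ ball 0 r, eval (graphPoint f x) P = 0) :
    ∃ Q : MvPolynomial (Fin (n + 1)) ℝ, Q.totalDegree ≤ d ∧
      (∀ x ∈ ball 0 r, eval (graphPoint f x) Q = 0) ∧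
      ∃ x ∈ ball 0 r, eval (graphPoint f x) (pderiv (Fin.last n) Q) ≠ 0 := by
  let S : Set (MvPolynomial (Fin (n + 1)) ℝ) :=
    {Q | Q ≠ 0 ∧ ∀ x ∈ ball 0 r, eval (graphPoint f x) Q = 0}
  obtain ⟨Q, ⟨hQ0, hQf⟩, hmin⟩ :=
    (measure fun Q : MvPolynomial (Fin (n + 1)) ℝ => Q.totalDegree).wf.has_min S ⟨P, hP0, hPf⟩
  have hQd : Q.totalDegree ≤ P.totalDegree := not_lt.1 (hmin P ⟨hP0, hPf⟩)
  refine ⟨Q, hQd.trans hP, hQf, ?_⟩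
  by_contra! hcon
  have h0 : (0 : EuclideanSpace ℝ (Fin n)) ∈ ball 0 r := mem_ball_self hr
  have hconst : ∀ c : ℝ, Q ≠ C c := by
    rintro c rfl
    have := hQf 0 h0
    rw [eval_C] at this
    exact hQ0 (by rw [this, C_0])
  have hpos : 0 < Q.totalDegree := by
    rw [pos_iff_ne_zero, Ne, totalDegree_eq_zero_iff_eq_C]
    exact hconst _
  have hzero : ∀ i, (∀ x ∈ ball 0 r, eval (graphPoint f x) (pderiv i Q) = 0) →
      pderiv i Q = 0 := by
    intro i hi
    by_contra h
    have h1 := hmin (pderiv i Q) ⟨h, hi⟩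
    have h2 := totalDegree_pderiv_le i Q
    exact h1 (show (pderiv i Q).totalDegree < Q.totalDegree by omega)
  refine hconst _ (eq_C_of_pderiv_eq_zero fun i => hzero i ?_)
  refine Fin.lastCases hcon (fun l x hx => ?_) i
  have h1 := pderiv_add_mul_gradient_eq_zero (hf x hx)
    (eventually_of_mem (isOpen_ball.mem_nhds hx) hQf) l
  rwa [hcon x hx, zero_mul, add_zero] at h1

lemma eventually_pow_le_norm_gradient_pow_of_pos {n d κ : ℕ} (hd : 0 < d)
    (hκ : (5 * d) ^ (n + 1) < κ) {f : EuclideanSpace ℝ (Fin n) → ℝ} {r : ℝ} (hr : 0 < r)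
    (hr1 : r ≤ 1) (hf : AnalyticOnNhd ℝ f (ball 0 r)) (hf0 : f 0 = 0)
    {P : MvPolynomial (Fin (n + 1)) ℝ} (hP0 : P ≠ 0) (hP : P.totalDegree ≤ d)
    (hPf : ∀ x ∈ ball 0 r, eval (graphPoint f x) P = 0) :
    ∀ᶠ x in 𝓝 0, 0 < f x → f x ^ (κ - 1) ≤ ‖gradient f x‖ ^ κ := by
  obtain ⟨Q, hQd, hQf, hQy⟩ := exists_pderiv_last_ne_zero hr
    (fun x hx => (hf x hx).differentiableAt) hP0 hP hPf
  by_contra hcon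
  have hfreq : ∃ᶠ x in 𝓝 (0 : EuclideanSpace ℝ (Fin n)),
      0 < f x ∧ ‖gradient f x‖ ^ κ < f x ^ (κ - 1) := by
    rw [Filter.Frequently]
    simpa using hcon
  have hfc : Tendsto f (𝓝 0) (𝓝 0) := by
    simpa [hf0] using (hf 0 (mem_ball_self hr)).continuousAt.tendsto
  have hev : ∀ᶠ x in 𝓝 (0 : EuclideanSpace ℝ (Fin n)), ‖x‖ ≤ r / 2 ∧ f x ≤ 1 := by
    refine Filter.Eventually.and ?_ (hfc.eventually (eventually_le_nhds one_pos))
    filter_upwards [closedBall_mem_nhds (0 : EuclideanSpace ℝ (Fin n)) (half_pos hr)] with x hx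
    simpa using hx
  obtain ⟨x, hx0, hx⟩ := exists_seq_forall_of_frequently (hfreq.and_eventually hev)
  exact false_of_gradient_small_seq hd hκ hr hr1 hf hQd hQf hQy (fun j => (hx j).2.1)
    (fun j => (hx j).1.1) (fun j => (hx j).2.2) (hfc.comp hx0) (fun j => (hx j).1.2.le)

lemma gradient_fun_neg {n : ℕ} {f : EuclideanSpace ℝ (Fin n) → ℝ}
    (x : EuclideanSpace ℝ (Fin n)) : gradient (fun z => -f z) x = -gradient f x := by
  simp [gradient, fderiv_fun_neg]

/-- Gradient inequality with explicit exponent for algebraic functions. -/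
lemma eventually_pow_le_norm_gradient_pow {n d κ : ℕ} (hd : 0 < d)
    (hκ : (5 * d) ^ (n + 1) < κ) {f : EuclideanSpace ℝ (Fin n) → ℝ} {r : ℝ} (hr : 0 < r)
    (hr1 : r ≤ 1) (hf : AnalyticOnNhd ℝ f (ball 0 r)) (hf0 : f 0 = 0)
    {P : MvPolynomial (Fin (n + 1)) ℝ} (hP0 : P ≠ 0) (hP : P.totalDegree ≤ d)
    (hPf : ∀ x ∈ ball 0 r, eval (graphPoint f x) P = 0) :
    ∀ᶠ x in 𝓝 0, f x ≠ 0 → |f x| ^ (κ - 1) ≤ ‖gradient f x‖ ^ κ := by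
  let g : Fin (n + 1) → MvPolynomial (Fin (n + 1)) ℝ :=
    Fin.snoc (fun i => X i.castSucc) (-X (Fin.last n))
  have hg : ∀ i, (g i).totalDegree ≤ 1 := fun i => by
    refine Fin.lastCases ?_ (fun l => ?_) i <;> simp [g]
  have hgg : (aeval g).comp (aeval g) = AlgHom.id ℝ (MvPolynomial (Fin (n + 1)) ℝ) := by
    ext1 i
    refine Fin.lastCases ?_ (fun l => ?_) i <;> simp [g]
  have hg0 : aeval g P ≠ 0 := by
    intro h
    have h1 : aeval g (aeval g P) = P := DFunLike.congr_fun hgg P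
    rw [h, map_zero] at h1
    exact hP0 h1.symm
  have hgf : ∀ x ∈ ball 0 r, eval (graphPoint (fun z => -f z) x) (aeval g P) = 0 := by
    intro x hx
    rw [← hPf x hx]
    have : (aeval (graphPoint (fun z => -f z) x)).comp (aeval g) =
        (aeval (graphPoint f x) : MvPolynomial (Fin (n + 1)) ℝ →ₐ[ℝ] ℝ) := by
      ext1 i
      refine Fin.lastCases ?_ (fun l => ?_) i <;> simp [g, graphPoint]
    simpa [aeval_eq_eval] using DFunLike.congr_fun this P
  filter_upwards [eventually_pow_le_norm_gradient_pow_of_pos hd hκ hr hr1 hf hf0 hP0 hP hPf,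
    eventually_pow_le_norm_gradient_pow_of_pos (f := fun z => -f z) hd hκ hr hr1 hf.neg (by simp [hf0]) hg0
      ((totalDegree_aeval_le_of_le_one hg P).trans hP) hgf] with x h1 h2 h3
  rcases lt_or_gt_of_ne h3 with h | h
  · rw [abs_of_neg h]
    simpa [gradient_fun_neg] using h2 (by linarith)
  · rw [abs_of_pos h]
    exact h1 h

/-- A nonzero analytic function satisfying an affine equation has nonzero gradient. -/
lemma gradient_ne_zero_of_totalDegree_le_one {n : ℕ} {f : EuclideanSpace ℝ (Fin n) → ℝ} {r : ℝ}
    (hr : 0 < r) (hf : ∀ x ∈ ball (0 : EuclideanSpace ℝ (Fin n)) r, DifferentiableAt ℝ f x)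
    (hf0 : f 0 = 0) (hne : ∃ x ∈ ball (0 : EuclideanSpace ℝ (Fin n)) r, f x ≠ 0)
    {P : MvPolynomial (Fin (n + 1)) ℝ} (hP0 : P ≠ 0) (hP : P.totalDegree ≤ 1)
    (hPf : ∀ x ∈ ball 0 r, eval (graphPoint f x) P = 0) : gradient f 0 ≠ 0 := by
  obtain ⟨Q, hQd, hQf, y, hy, hQy⟩ := exists_pderiv_last_ne_zero hr hf hP0 hP hPf
  intro hgrad
  have hconst : ∀ i, ∃ c : ℝ, pderiv i Q = C c := fun i => by
    refine ⟨_, totalDegree_eq_zero_iff_eq_C.1 ?_⟩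
    have := totalDegree_pderiv_le i Q
    omega
  choose c hc using hconst
  have hcl : c (Fin.last n) ≠ 0 := by simpa [hc] using hQy
  have hkey : ∀ x ∈ ball 0 r, ∀ i : Fin n,
      c i.castSucc + c (Fin.last n) * gradient f x i = 0 := fun x hx i => by
    simpa [hc] using pderiv_add_mul_gradient_eq_zero (hf x hx)
      (eventually_of_mem (isOpen_ball.mem_nhds hx) hQf) i
  have hci : ∀ i : Fin n, c i.castSucc = 0 := fun i => by
    simpa [hgrad] using hkey 0 (mem_ball_self hr) i
  have hg : ∀ x ∈ ball 0 r, gradient f x = 0 := fun x hx => by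
    ext i
    simpa [hci, hcl] using hkey x hx i
  obtain ⟨x, hx, hfx⟩ := hne
  refine hfx ?_
  rw [← hf0]
  refine isOpen_ball.is_const_of_fderiv_eq_zero (𝕜 := ℝ) (convex_ball _ _).isPreconnected
    (fun z hz => (hf z hz).differentiableWithinAt) (fun z hz => ?_) hx (mem_ball_self hr)
  have := hg z hz
  simpa [gradient] using this
end

section
open Filter Topology Metric

/-- The gradient inequality implies a lower bound by a power of the distance to the zero set. -/
lemma exists_zero_norm_sub_pow_le {n κ : ℕ} (hκ : 0 < κ) {f : EuclideanSpace ℝ (Fin n) → ℝ}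
    {r C : ℝ} (hr : 0 < r) (hC : 0 < C)
    (hf : ∀ x ∈ ball (0 : EuclideanSpace ℝ (Fin n)) r, DifferentiableAt ℝ f x) (hf0 : f 0 = 0)
    (hG : ∀ x ∈ ball (0 : EuclideanSpace ℝ (Fin n)) r, f x ≠ 0 →
      |f x| ^ (κ - 1) ≤ C * ‖gradient f x‖ ^ κ) :
    ∃ C' > 0, ∀ᶠ x in 𝓝 0, ∃ z ∈ ball 0 r, f z = 0 ∧ ‖x - z‖ ^ κ ≤ C' * |f x| := by
  have hκ0 : (0 : ℝ) < κ := by exact_mod_cast hκ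
  set c : ℝ := (κ * (C + 1))⁻¹
  have hc : 0 < c := by positivity
  have hcC : C * (κ * c) ^ κ < 1 := by
    have h1 : κ * c = (C + 1)⁻¹ := by simp only [c]; field_simp
    have h2 : (κ * c) ^ κ ≤ (C + 1)⁻¹ := by
      rw [h1]
      exact pow_le_of_le_one (by positivity) (inv_le_one_of_one_le₀ (by linarith)) hκ.ne'
    calc C * (κ * c) ^ κ ≤ C * (C + 1)⁻¹ := by gcongr
      _ < 1 := by
        rw [← div_eq_mul_inv, div_lt_one (by linarith)]
        linarith
  let T : EuclideanSpace ℝ (Fin n) → ℝ := fun y => (f y ^ 2) ^ ((2 * κ : ℝ)⁻¹)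
  have hT0 : ∀ y, 0 ≤ T y := fun y => by positivity
  have hTκ : ∀ y, T y ^ κ = |f y| := fun y => by
    simp only [T]
    rw [← Real.rpow_natCast, ← Real.rpow_mul (sq_nonneg _), ← Real.sqrt_sq_eq_abs,
      Real.sqrt_eq_rpow]
    congr 1
    field_simp
  have hTc : ∀ y ∈ ball (0 : EuclideanSpace ℝ (Fin n)) r, ContinuousAt T y := fun y hy =>
    ((hf y hy).continuousAt.pow 2).rpow_const (Or.inr (by positivity))
  have hT00 : T 0 = 0 := by
    have := hTκ 0
    rw [hf0, abs_zero] at this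
    exact eq_zero_of_pow_eq_zero this
  refine ⟨(2 / c) ^ κ, by positivity, ?_⟩
  have hsmall : ∀ᶠ x in 𝓝 (0 : EuclideanSpace ℝ (Fin n)), T x < c * r / 8 := by
    have := (hTc 0 (mem_ball_self hr)).tendsto
    rw [hT00] at this
    exact this.eventually (gt_mem_nhds (by positivity))
  filter_upwards [hsmall, ball_mem_nhds (0 : EuclideanSpace ℝ (Fin n)) (show 0 < r / 4 by linarith)]
    with x hxT hxr
  rw [mem_ball_zero_iff] at hxr
  by_cases hfx : f x = 0
  · refine ⟨x, by rw [mem_ball_zero_iff]; linarith, hfx, ?_⟩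
    simp [hfx, hκ.ne']
  have hTx : 0 < T x := by
    refine lt_of_le_of_ne (hT0 x) fun h => hfx ?_
    have := hTκ x
    rw [← h, zero_pow hκ.ne'] at this
    exact abs_eq_zero.1 this.symm
  set l : ℝ := c ^ 2 / (4 * T x)
  have hl : 0 < l := by positivity
  have hKr : closedBall (0 : EuclideanSpace ℝ (Fin n)) (r / 2) ⊆ ball 0 r :=
    closedBall_subset_ball (by linarith)
  have hxK : x ∈ closedBall (0 : EuclideanSpace ℝ (Fin n)) (r / 2) := by
    rw [mem_closedBall_zero_iff]; linarith
  obtain ⟨y, hyK, hy⟩ := (isCompact_closedBall (0 : EuclideanSpace ℝ (Fin n)) (r / 2)).exists_isMinOn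
    ⟨x, hxK⟩ (f := fun y => T y + l * ‖y - x‖ ^ 2) (fun z hz =>
      ((hTc z (hKr hz)).add (by fun_prop)).continuousWithinAt)
  have hyx : T y + l * ‖y - x‖ ^ 2 ≤ T x := by
    have h : T y + l * ‖y - x‖ ^ 2 ≤ T x + l * ‖x - x‖ ^ 2 := hy hxK
    simpa using h
  have hd : ‖y - x‖ ≤ 2 / c * T x := by
    refine le_of_sq_le_sq ?_ (by positivity)
    have h1 : l * ‖y - x‖ ^ 2 ≤ T x := by linarith [hT0 y]
    have h2 : l * (2 / c * T x) ^ 2 = T x := by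
      simp only [l]; field_simp; norm_num
    nlinarith
  have hd2 : 2 / c * T x < r / 4 := by
    rw [div_mul_eq_mul_div, div_lt_iff₀ hc]
    linarith
  have hyr : ‖y‖ < r / 2 := by
    have : ‖y‖ ≤ ‖y - x‖ + ‖x‖ := by simpa using norm_add_le (y - x) x
    linarith
  have hyb : y ∈ ball (0 : EuclideanSpace ℝ (Fin n)) r := hKr hyK
  refine ⟨y, hyb, ?_, ?_⟩
  swap
  · rw [norm_sub_rev, ← hTκ, ← mul_pow]
    gcongr
  by_contra hfy
  have hloc : IsLocalMin (fun y => T y + l * ‖y - x‖ ^ 2) y :=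
    hy.isLocalMin (closedBall_mem_nhds_of_mem (by simpa using hyr))
  have hfy2 : 0 < f y ^ 2 := by positivity
  have hTd : HasFDerivAt T (((2 * κ : ℝ)⁻¹ * (f y ^ 2) ^ ((2 * κ : ℝ)⁻¹ - 1)) •
      ((2 * f y) • fderiv ℝ f y)) y := by
    have h1 := (hf y hyb).hasFDerivAt.pow 2
    have h2 := h1.rpow_const (p := (2 * κ : ℝ)⁻¹) (Or.inl hfy2.ne')
    refine h2.congr_fderiv ?_
    simp
  have hTy : 0 < T y := Real.rpow_pos_of_pos hfy2 _
  have hnorm : ‖fderiv ℝ T y‖ = T y / |f y| * ‖fderiv ℝ f y‖ / κ := by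
    rw [hTd.fderiv, norm_smul, norm_smul, Real.rpow_sub_one hfy2.ne', norm_mul, norm_mul, norm_div]
    change ‖(2 * κ : ℝ)⁻¹‖ * (‖T y‖ / _) * _ = _
    rw [Real.norm_of_nonneg hTy.le, norm_pow, norm_inv, norm_mul]
    simp only [Real.norm_eq_abs, Nat.abs_cast, Nat.abs_ofNat]
    have : 0 < |f y| := abs_pos.2 hfy
    field_simp
  have hle : ‖fderiv ℝ T y‖ ≤ c := by
    have h1 : HasFDerivAt (fun z => l * ‖z - x‖ ^ 2) (l • (2 • innerSL ℝ (y - x))) y := by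
      have h3 := ((hasFDerivAt_id y).sub_const x).norm_sq.const_mul l
      simpa using h3
    have h2 := hloc.hasFDerivAt_eq_zero (hTd.differentiableAt.hasFDerivAt.add h1)
    rw [eq_neg_of_add_eq_zero_left h2, norm_neg, norm_smul, Real.norm_of_nonneg hl.le]
    have h4 : ‖2 • innerSL ℝ (y - x)‖ ≤ 2 * ‖y - x‖ := by
      rw [two_nsmul]
      refine (norm_add_le _ _).trans ?_
      rw [innerSL_apply_norm]
      linarith
    calc l * ‖2 • innerSL ℝ (y - x)‖ ≤ l * (2 * (2 / c * T x)) := by gcongr; linarith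
      _ = c := by simp only [l]; field_simp; norm_num
  have hg : ‖gradient f y‖ = ‖fderiv ℝ f y‖ := by simp [gradient]
  have h1 := hG y hyb hfy
  have hfa : 0 < |f y| := abs_pos.2 hfy
  have h2 : ‖fderiv ℝ f y‖ ^ κ = (κ * ‖fderiv ℝ T y‖) ^ κ * |f y| ^ (κ - 1) := by
    have h3 : κ * ‖fderiv ℝ T y‖ * |f y| = T y * ‖fderiv ℝ f y‖ := by
      rw [hnorm]; field_simp
    have h4 := congrArg (· ^ κ) h3
    simp only [mul_pow _ _ κ, hTκ] at h4
    obtain ⟨m, rfl⟩ : ∃ m, κ = m + 1 := ⟨κ - 1, by omega⟩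
    rw [pow_succ |f y|] at h4
    simp only [Nat.add_sub_cancel, mul_pow]
    refine mul_left_cancel₀ hfa.ne' ?_
    rw [← h4]
    ring
  rw [hg, h2] at h1
  have h5 : C * ((κ * ‖fderiv ℝ T y‖) ^ κ * |f y| ^ (κ - 1)) ≤
      (C * (κ * c) ^ κ) * |f y| ^ (κ - 1) := by
    rw [mul_assoc]
    gcongr
  have h6 : 0 < |f y| ^ (κ - 1) := by positivity
  nlinarith

/-- Taylor estimate for functions flat along a set, uniform in the base point. -/
lemma exists_abs_le_mul_norm_sub_pow {E : Type*} [NormedAddCommGroup E] [NormedSpace ℝ E] {k : ℕ}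
    {h : E → ℝ} {a : E} (hh : ContDiffAt ℝ k h a) :
    ∃ C > 0, ∃ r > 0, ∀ x ∈ ball a r, ∀ z ∈ ball a r,
      (∀ i ≤ k, iteratedFDeriv ℝ i h z = 0) → |h x| ≤ C * ‖x - z‖ ^ k := by
  have hcd : ∀ᶠ x in 𝓝 a, ContDiffAt ℝ k h x := hh.eventually (by simp)
  have hb : ∀ᶠ x in 𝓝 a, ‖iteratedFDeriv ℝ k h x‖ < ‖iteratedFDeriv ℝ k h a‖ + 1 :=
    (hh.continuousAt_iteratedFDeriv le_rfl).norm.eventually (gt_mem_nhds (lt_add_one _))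
  obtain ⟨r, hr, hball⟩ := Metric.eventually_nhds_iff_ball.1 (hcd.and hb)
  set C := ‖iteratedFDeriv ℝ k h a‖ + 1
  have hC : 0 < C := by positivity
  refine ⟨C, hC, r, hr, fun x hx z hz hzero => ?_⟩
  have key : ∀ j ≤ k, ∀ x ∈ ball a r, ‖iteratedFDeriv ℝ (k - j) h x‖ ≤ C * ‖x - z‖ ^ j := by
    intro j
    induction j with
    | zero => intro _ x hx; simpa using (hball x hx).2.le
    | succ j ih =>
      intro hj x hx
      have hkj : k - j = k - (j + 1) + 1 := by omega
      have hseg : segment ℝ z x ⊆ ball a r := (convex_ball a r).segment_subset hz hx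
      have h1 := Convex.norm_image_sub_le_of_norm_fderiv_le (𝕜 := ℝ)
        (f := iteratedFDeriv ℝ (k - (j + 1)) h) (s := segment ℝ z x) (C := C * ‖x - z‖ ^ j)
        (fun w hw => (hball w (hseg hw)).1.differentiableAt_iteratedFDeriv (by
          exact_mod_cast (by omega : k - (j + 1) < k)))
        (fun w hw => by
          rw [norm_fderiv_iteratedFDeriv, ← hkj]
          refine (ih (by omega) w (hseg hw)).trans ?_
          gcongr
          obtain ⟨t, ht, rfl⟩ := (segment_eq_image' ℝ z x ▸ hw : w ∈ _)
          simp only [add_sub_cancel_left, norm_smul]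
          rw [Real.norm_of_nonneg ht.1]
          exact mul_le_of_le_one_left (norm_nonneg _) ht.2)
        (convex_segment z x) (left_mem_segment ℝ z x) (right_mem_segment ℝ z x)
      rw [hzero _ (by omega), sub_zero] at h1
      rw [pow_succ, ← mul_assoc]
      exact h1
  have h1 := key k le_rfl x hx
  rw [Nat.sub_self, norm_iteratedFDeriv_zero, Real.norm_eq_abs] at h1
  exact h1
end

section
open Filter Topology Metric

lemma five_mul_pow_add_two_le {n d : ℕ} (hn : 1 ≤ n) (hd : 2 ≤ d) :
    (5 * d) ^ (n + 1) + 2 ≤ 2 * (2 * d - 1) ^ (3 * n + 1) := by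
  obtain ⟨e, rfl⟩ : ∃ e, d = e + 2 := ⟨d - 2, by omega⟩
  have h1 : 2 * (e + 2) - 1 = 2 * e + 3 := by omega
  rw [h1]
  induction n, hn using Nat.le_induction with
  | base =>
    norm_num
    nlinarith [pow_nonneg (Nat.zero_le e) 4, pow_nonneg (Nat.zero_le e) 3,
      pow_nonneg (Nat.zero_le e) 2]
  | succ n _ ih =>
    have h2 : 5 * (e + 2) ≤ (2 * e + 3) ^ 3 := by
      nlinarith [pow_nonneg (Nat.zero_le e) 3, pow_nonneg (Nat.zero_le e) 2]
    calc (5 * (e + 2)) ^ (n + 1 + 1) + 2 ≤ ((5 * (e + 2)) ^ (n + 1) + 2) * (5 * (e + 2)) := by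
          rw [pow_succ _ (n + 1)]; nlinarith
      _ ≤ (2 * (2 * e + 3) ^ (3 * n + 1)) * (2 * e + 3) ^ 3 := Nat.mul_le_mul ih h2
      _ = 2 * (2 * e + 3) ^ (3 * (n + 1) + 1) := by ring

/-- The gradient inequality for a nonzero analytic function annihilated by a polynomial of
positive degree `d`. -/
lemma exists_eventually_pow_le_mul_norm_gradient_pow {n d κ : ℕ} (hd : 0 < d)
    (hκ : κ + 1 = 2 * (2 * d - 1) ^ (3 * n + 1)) {f : EuclideanSpace ℝ (Fin n) → ℝ} {r : ℝ}
    (hr : 0 < r) (hr1 : r ≤ 1) (hf : AnalyticOnNhd ℝ f (ball 0 r)) (hf0 : f 0 = 0)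
    (hne : ∃ x ∈ ball 0 r, f x ≠ 0) {P : MvPolynomial (Fin (n + 1)) ℝ} (hP0 : P ≠ 0)
    (hP : P.totalDegree ≤ d) (hPf : ∀ x ∈ ball 0 r, MvPolynomial.eval (graphPoint f x) P = 0) :
    ∃ C > 0, ∀ᶠ x in 𝓝 0, f x ≠ 0 → |f x| ^ (κ - 1) ≤ C * ‖gradient f x‖ ^ κ := by
  rcases Nat.eq_zero_or_pos n with rfl | hn
  · obtain ⟨x, -, hx⟩ := hne
    exact absurd (Subsingleton.elim x 0 ▸ hf0) hx
  rcases Nat.lt_or_ge d 2 with h | h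
  · obtain rfl : d = 1 := by omega
    obtain rfl : κ = 1 := by simpa using hκ
    have hg : 0 < ‖gradient f 0‖ := norm_pos_iff.2
      (gradient_ne_zero_of_totalDegree_le_one hr (fun x hx => (hf x hx).differentiableAt) hf0 hne
        hP0 hP hPf)
    have hc : ContinuousAt (gradient f) 0 :=
      (contDiffAt_gradient (m := 0) (N := 1) (hf 0 (mem_ball_self hr)).contDiffAt
        (by simp)).continuousAt
    refine ⟨2 / ‖gradient f 0‖, by positivity, ?_⟩
    filter_upwards [hc.norm.eventually (lt_mem_nhds (half_lt_self hg))] with x hx _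
    simp only [tsub_self, pow_zero, pow_one]
    rw [div_mul_eq_mul_div, le_div_iff₀ hg]
    linarith
  · have := five_mul_pow_add_two_le hn h
    refine ⟨1, one_pos, ?_⟩
    simpa using eventually_pow_le_norm_gradient_pow hd (κ := κ) (by omega) hr hr1 hf hf0 hP0 hP hPf

/-- A function with the same jet as `f` along the zero set of `f`, of order exceeding the exponent
of a gradient inequality for `f`, has no further zeros near the origin. -/
lemma eventually_eq_zero_of_iteratedFDeriv_eq {n κ : ℕ} (hκ : 0 < κ)
    {f g : EuclideanSpace ℝ (Fin n) → ℝ} {U W : Set (EuclideanSpace ℝ (Fin n))}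
    (hU : U ∈ 𝓝 0) (hf : AnalyticOnNhd ℝ f U) (hf0 : f 0 = 0)
    (hG : ∃ C > 0, ∀ᶠ x in 𝓝 0, f x ≠ 0 → |f x| ^ (κ - 1) ≤ C * ‖gradient f x‖ ^ κ)
    (hW : W ∈ 𝓝 0) (hg : ∀ x ∈ W, ContDiffAt ℝ (κ + 1 : ℕ) g x)
    (hfg : ∀ a ∈ W, a ∈ U → f a = 0 →
      ∀ i ≤ κ + 1, iteratedFDeriv ℝ i f a = iteratedFDeriv ℝ i g a) :
    ∀ᶠ x in 𝓝 0, g x = 0 → f x = 0 := by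
  obtain ⟨C, hC, hG⟩ := hG
  have hh : ∀ x ∈ W, x ∈ U → ContDiffAt ℝ (κ + 1 : ℕ) (f - g) x := fun x hx hxU =>
    (hf x hxU).contDiffAt.sub (hg x hx)
  obtain ⟨A, hA, s, hs, hAs⟩ := exists_abs_le_mul_norm_sub_pow
    (hh 0 (mem_of_mem_nhds hW) (mem_of_mem_nhds hU))
  obtain ⟨r, hr, hrS⟩ := Metric.mem_nhds_iff.1
    (inter_mem (inter_mem hU hW) (inter_mem hG (ball_mem_nhds _ hs)))
  obtain ⟨B, hB, hBx⟩ := exists_zero_norm_sub_pow_le hκ hr hC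
    (fun x hx => (hf x (hrS hx).1.1).differentiableAt) hf0 (fun x hx => (hrS hx).2.1)
  have hfc : ContinuousAt f 0 := (hf 0 (mem_of_mem_nhds hU)).continuousAt
  have hsmall : ∀ᶠ x in 𝓝 0, B * |f x| < (1 / (B * A + 1)) ^ κ := by
    have : ContinuousAt (fun x => B * |f x|) 0 := by fun_prop
    refine this.eventually (gt_mem_nhds ?_)
    simp only [hf0, abs_zero, mul_zero]
    positivity
  filter_upwards [hBx, hsmall, ball_mem_nhds 0 hr] with x ⟨z, hz, hfz, hxz⟩ hx hxr hgx
  suffices x = z by rwa [this]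
  by_contra hne
  have hpos : 0 < ‖x - z‖ := norm_pos_iff.2 (sub_ne_zero.2 hne)
  have hlt : ‖x - z‖ < 1 / (B * A + 1) :=
    lt_of_pow_lt_pow_left₀ κ (by positivity) (hxz.trans_lt hx)
  have hT : |f x| ≤ A * ‖x - z‖ ^ (κ + 1) := by
    have := hAs x (hrS hxr).2.2 z (hrS hz).2.2 fun i hi => by
      have hz' := hrS hz
      have hle : ((i : ℕ) : WithTop ℕ∞) ≤ ((κ + 1 : ℕ) : WithTop ℕ∞) := by exact_mod_cast hi
      rw [iteratedFDeriv_sub_apply (hf z hz'.1.1).contDiffAt ((hg z hz'.1.2).of_le hle),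
        hfg z hz'.1.2 hz'.1.1 hfz i hi, sub_self]
    simpa [hgx] using this
  have h1 : ‖x - z‖ ^ κ * 1 ≤ ‖x - z‖ ^ κ * (B * A * ‖x - z‖) := by
    calc ‖x - z‖ ^ κ * 1 ≤ B * |f x| := by rwa [mul_one]
      _ ≤ B * (A * ‖x - z‖ ^ (κ + 1)) := by gcongr
      _ = _ := by ring
  have h2 := le_of_mul_le_mul_left h1 (by positivity)
  rw [lt_div_iff₀ (by positivity)] at hlt
  nlinarith

end

theorem stmt_17 (n : ℕ) (U : Set (EuclideanSpace ℝ (Fin n))) (hUopen : IsOpen U)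
    (hUconn : IsConnected U) (h0U : (0 : EuclideanSpace ℝ (Fin n)) ∈ U)
    (f : EuclideanSpace ℝ (Fin n) → ℝ) (hf : AnalyticOnNhd ℝ f U)
    (hfne : ∃ x ∈ U, f x ≠ 0) (hf0 : f 0 = 0)
    (P : MvPolynomial (Fin (n + 1)) ℝ) (hPirr : Irreducible P)
    (hPf : ∀ x ∈ U, MvPolynomial.eval (Fin.snoc (fun i => x i) (f x)) P = 0)
    (d : ℕ) (hd : d = P.totalDegree)
    (Z : Set (EuclideanSpace ℝ (Fin n))) (hZ : Z = {x ∈ U | f x = 0})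
    (k : ℕ) (hk : k = 2 * (2 * d - 1) ^ (3 * n + 1))
    (U₁ U₂ : Set (EuclideanSpace ℝ (Fin n)))
    (hU₁ : IsOpen U₁) (h0U₁ : (0 : EuclideanSpace ℝ (Fin n)) ∈ U₁)
    (hU₂ : IsOpen U₂) (h0U₂ : (0 : EuclideanSpace ℝ (Fin n)) ∈ U₂)
    (f₁ f₂ : EuclideanSpace ℝ (Fin n) → ℝ)
    (hf₁ : ContDiffOn ℝ k f₁ U₁) (hf₂ : ContDiffOn ℝ k f₂ U₂)
    (hreal₁ : ∃ W ∈ nhds (0 : EuclideanSpace ℝ (Fin n)), W ⊆ U₁ ∧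
      ∀ a ∈ Z ∩ W, ∀ i ≤ k, iteratedFDeriv ℝ i f a = iteratedFDeriv ℝ i f₁ a)
    (hreal₂ : ∃ W ∈ nhds (0 : EuclideanSpace ℝ (Fin n)), W ⊆ U₂ ∧
      ∀ a ∈ Z ∩ W, ∀ i ≤ k, iteratedFDeriv ℝ i f a = iteratedFDeriv ℝ i f₂ a) :
    ∃ Ω₁ Ω₂ : Set (EuclideanSpace ℝ (Fin n)), IsOpen Ω₁ ∧ IsOpen Ω₂ ∧
      (0 : EuclideanSpace ℝ (Fin n)) ∈ Ω₁ ∧ (0 : EuclideanSpace ℝ (Fin n)) ∈ Ω₂ ∧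
      Ω₁ ⊆ U₁ ∧ Ω₂ ⊆ U₂ ∧
      ∃ φ : ((f₁ ⁻¹' {0} ∪ Z) ∩ Ω₁ : Set (EuclideanSpace ℝ (Fin n))) ≃ₜ
            ((f₂ ⁻¹' {0} ∪ Z) ∩ Ω₂ : Set (EuclideanSpace ℝ (Fin n))),
        (∃ h0 : (0 : EuclideanSpace ℝ (Fin n)) ∈ (f₁ ⁻¹' {0} ∪ Z) ∩ Ω₁,
          ((φ ⟨0, h0⟩ : ((f₂ ⁻¹' {0} ∪ Z) ∩ Ω₂ : Set (EuclideanSpace ℝ (Fin n)))) :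
            EuclideanSpace ℝ (Fin n)) = 0) ∧
        {y : EuclideanSpace ℝ (Fin n) |
          ∃ x : ((f₁ ⁻¹' {0} ∪ Z) ∩ Ω₁ : Set (EuclideanSpace ℝ (Fin n))),
            (x : EuclideanSpace ℝ (Fin n)) ∈ Z ∧
            ((φ x : ((f₂ ⁻¹' {0} ∪ Z) ∩ Ω₂ : Set (EuclideanSpace ℝ (Fin n)))) :
              EuclideanSpace ℝ (Fin n)) = y} = Z ∩ Ω₂ := by
  have hd0 : 0 < d := by
    rw [hd, Nat.pos_iff_ne_zero]
    intro h
    rw [MvPolynomial.totalDegree_eq_zero_iff_eq_C] at h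
    have h0 := hPf 0 h0U
    rw [h, MvPolynomial.eval_C] at h0
    rw [h0, map_zero] at h
    exact hPirr.ne_zero h
  obtain ⟨r, hr, hrU⟩ := Metric.mem_nhds_iff.1 (hUopen.mem_nhds h0U)
  have hsub : Metric.ball (0 : EuclideanSpace ℝ (Fin n)) (min r 1) ⊆ U :=
    (Metric.ball_subset_ball (min_le_left _ _)).trans hrU
  have hr1 : 0 < min r 1 := lt_min hr one_pos
  have hne : ∃ x ∈ Metric.ball (0 : EuclideanSpace ℝ (Fin n)) (min r 1), f x ≠ 0 := by
    by_contra! h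
    obtain ⟨x, hxU, hx⟩ := hfne
    exact hx (hf.eqOn_zero_of_preconnected_of_eventuallyEq_zero hUconn.isPreconnected h0U
      (Filter.eventually_of_mem (Metric.ball_mem_nhds _ hr1) h) hxU)
  have hpow : 0 < (2 * d - 1) ^ (3 * n + 1) := Nat.pow_pos (by omega)
  obtain ⟨κ, rfl⟩ : ∃ κ, k = κ + 1 := ⟨k - 1, by omega⟩
  have hG := exists_eventually_pow_le_mul_norm_gradient_pow hd0 hk hr1 (min_le_right _ _)
    (hf.mono hsub) hf0 hne hPirr.ne_zero hd.ge (fun x hx => hPf x (hsub hx))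
  have key : ∀ (V : Set (EuclideanSpace ℝ (Fin n))) (g : EuclideanSpace ℝ (Fin n) → ℝ),
      IsOpen V → ContDiffOn ℝ (κ + 1 : ℕ) g V →
      (∃ W ∈ nhds (0 : EuclideanSpace ℝ (Fin n)), W ⊆ V ∧ ∀ a ∈ Z ∩ W, ∀ i ≤ κ + 1,
        iteratedFDeriv ℝ i f a = iteratedFDeriv ℝ i g a) →
      ∀ᶠ x in nhds 0, g x = 0 → f x = 0 := by
    rintro V g hV hg ⟨W, hW, hWV, hfg⟩
    exact eventually_eq_zero_of_iteratedFDeriv_eq (by omega) (hUopen.mem_nhds h0U) hf hf0 hG hW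
      (fun x hx => hg.contDiffAt (hV.mem_nhds (hWV hx)))
      (fun a ha haU hfa => hfg a ⟨hZ ▸ ⟨haU, hfa⟩, ha⟩)
  obtain ⟨ρ, hρ, hρS⟩ := Metric.mem_nhds_iff.1 (Filter.inter_mem (hUopen.mem_nhds h0U)
    (Filter.inter_mem (Filter.inter_mem (hU₁.mem_nhds h0U₁) (hU₂.mem_nhds h0U₂))
      (Filter.inter_mem (key U₁ f₁ hU₁ hf₁ hreal₁) (key U₂ f₂ hU₂ hf₂ hreal₂))))
  have h0Z : (0 : EuclideanSpace ℝ (Fin n)) ∈ Z := hZ ▸ ⟨h0U, hf0⟩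
  have h0ρ : (0 : EuclideanSpace ℝ (Fin n)) ∈ Metric.ball 0 ρ := Metric.mem_ball_self hρ
  have e₁ : (f₁ ⁻¹' {0} ∪ Z) ∩ Metric.ball 0 ρ = Z ∩ Metric.ball 0 ρ := by
    refine Set.Subset.antisymm ?_ (Set.inter_subset_inter_left _ Set.subset_union_right)
    rintro x ⟨hx | hx, hxρ⟩
    · exact ⟨hZ ▸ ⟨(hρS hxρ).1, (hρS hxρ).2.2.1 hx⟩, hxρ⟩
    · exact ⟨hx, hxρ⟩
  have e₂ : (f₂ ⁻¹' {0} ∪ Z) ∩ Metric.ball 0 ρ = Z ∩ Metric.ball 0 ρ := by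
    refine Set.Subset.antisymm ?_ (Set.inter_subset_inter_left _ Set.subset_union_right)
    rintro x ⟨hx | hx, hxρ⟩
    · exact ⟨hZ ▸ ⟨(hρS hxρ).1, (hρS hxρ).2.2.2 hx⟩, hxρ⟩
    · exact ⟨hx, hxρ⟩
  refine ⟨Metric.ball 0 ρ, Metric.ball 0 ρ, Metric.isOpen_ball, Metric.isOpen_ball, h0ρ, h0ρ,
    fun x hx => (hρS hx).2.1.1, fun x hx => (hρS hx).2.1.2,
    Homeomorph.setCongr (e₁.trans e₂.symm), ⟨⟨Or.inr h0Z, h0ρ⟩, rfl⟩, ?_⟩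
  ext y
  constructor
  · rintro ⟨x, hxZ, rfl⟩
    exact ⟨hxZ, x.2.2⟩
  · rintro ⟨hyZ, hyρ⟩
    exact ⟨⟨y, Or.inr hyZ, hyρ⟩, hyZ, rfl⟩
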